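/- arXiv:2002.02233 — 5 statements merged into one kernel-verified Lean document; each statement's English description precedes it below -/
import Mathlib

section
/- Hölder's inequality for variable exponent Lebesgue spaces: for all measurable functions u, v : Ω → ℝ, one has ∫_Ω |u(x) v(x)| d𝔪 ≤ 2 ‖u‖_{p(·)} ‖v‖_{p'(·)} (an inequality in [0, +∞]). -/
open MeasureTheory Filter Topology
open scoped ENNReal NNReal

/-- The modular `ρ_{p(·)}(u) = ∫_Ω |u(x)|^{p(x)} d𝔪` of a variable exponent Lebesgue space. -/
noncomputable def modular {Ω : Type*} [MeasurableSpace Ω] (m : Measure Ω)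
    (p : Ω → ℝ) (u : Ω → ℝ) : ℝ≥0∞ :=
  ∫⁻ x, ENNReal.ofReal (|u x| ^ p x) ∂m

/-- The Luxemburg norm `‖u‖_{p(·)} = inf {λ > 0 : ρ_{p(·)}(u/λ) ≤ 1}`, with `inf ∅ = +∞`. -/
noncomputable def luxNorm {Ω : Type*} [MeasurableSpace Ω] (m : Measure Ω)
    (p : Ω → ℝ) (u : Ω → ℝ) : ℝ≥0∞ :=
  sInf ((fun l : ℝ => ENNReal.ofReal l) ''
    {l : ℝ | 0 < l ∧ modular m p (fun x => u x / l) ≤ 1})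

lemma exists_modular_le_one_of_luxNorm_lt {Ω : Type*} [MeasurableSpace Ω] {m : Measure Ω}
    {p u : Ω → ℝ} {a : ℝ≥0∞} (h : luxNorm m p u < a) :
    ∃ l : ℝ, 0 < l ∧ ENNReal.ofReal l < a ∧ modular m p (fun x => u x / l) ≤ 1 := by
  obtain ⟨_, ⟨l, ⟨hl, hmod⟩, rfl⟩, hla⟩ := sInf_lt_iff.1 h
  exact ⟨l, hl, hla, hmod⟩

lemma modular_le_mul_modular_div {Ω : Type*} [MeasurableSpace Ω] {m : Measure Ω}
    {p u : Ω → ℝ} (hp : ∀ᵐ x ∂m, 1 ≤ p x) {l : ℝ} (hl : 0 < l) (hl1 : l ≤ 1) :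
    modular m p u ≤ ENNReal.ofReal l * modular m p (fun x => u x / l) := by
  unfold modular
  rw [← lintegral_const_mul' _ _ ENNReal.ofReal_ne_top]
  refine lintegral_mono_ae ?_
  filter_upwards [hp] with x hx
  rw [← ENNReal.ofReal_mul hl.le]
  refine ENNReal.ofReal_le_ofReal ?_
  have hu : |u x| = l * |u x / l| := by
    rw [abs_div, abs_of_pos hl]
    field_simp
  rw [hu, Real.mul_rpow hl.le (abs_nonneg _)]
  gcongr
  simpa using Real.rpow_le_rpow_of_exponent_ge hl hl1 hx

lemma ae_eq_zero_of_luxNorm_eq_zero {Ω : Type*} [MeasurableSpace Ω] {m : Measure Ω}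
    {p u : Ω → ℝ} (hp : Measurable p) (hu : Measurable u) (hp1 : ∀ᵐ x ∂m, 1 ≤ p x)
    (h : luxNorm m p u = 0) : ∀ᵐ x ∂m, u x = 0 := by
  have hmod : modular m p u = 0 := by
    refine le_antisymm (le_of_forall_gt fun a ha => ?_) zero_le
    obtain ⟨l, hl, hla, hle⟩ := exists_modular_le_one_of_luxNorm_lt
      (h.trans_lt (lt_min ha one_pos))
    have hl1 : l ≤ 1 := ENNReal.ofReal_le_one.1 (hla.trans_le (min_le_right _ _)).le
    calc modular m p u ≤ ENNReal.ofReal l * modular m p (fun x => u x / l) :=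
          modular_le_mul_modular_div hp1 hl hl1
      _ ≤ ENNReal.ofReal l := mul_le_of_le_one_right' hle
      _ < a := hla.trans_le (min_le_left _ _)
  have hmeas : Measurable fun x => ENNReal.ofReal (|u x| ^ p x) :=
    ((measurable_norm.comp hu).pow hp).ennreal_ofReal
  filter_upwards [(lintegral_eq_zero_iff hmeas).1 hmod, hp1] with x hx hpx
  by_contra hux
  exact (Real.rpow_pos_of_pos (abs_pos.2 hux) (p x)).not_ge (ENNReal.ofReal_eq_zero.1 hx)

lemma lintegral_abs_mul_le_of_modular_le_one {Ω : Type*} [MeasurableSpace Ω] {m : Measure Ω}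
    {p q u v : Ω → ℝ} (hp : Measurable p) (hu : Measurable u)
    (hpq : ∀ᵐ x ∂m, (p x).HolderConjugate (q x)) {k l : ℝ} (hk : 0 < k) (hl : 0 < l)
    (hku : modular m p (fun x => u x / k) ≤ 1) (hlv : modular m q (fun x => v x / l) ≤ 1) :
    ∫⁻ x, ENNReal.ofReal |u x * v x| ∂m ≤ ENNReal.ofReal k * ENNReal.ofReal l * 2 := by
  have hmeas : Measurable fun x => ENNReal.ofReal (|u x / k| ^ p x) :=
    ((measurable_norm.comp (hu.div_const k)).pow hp).ennreal_ofReal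
  calc ∫⁻ x, ENNReal.ofReal |u x * v x| ∂m
      ≤ ∫⁻ x, ENNReal.ofReal k * ENNReal.ofReal l *
          (ENNReal.ofReal (|u x / k| ^ p x) + ENNReal.ofReal (|v x / l| ^ q x)) ∂m := by
        refine lintegral_mono_ae ?_
        filter_upwards [hpq] with x hx
        have hA : 0 ≤ |u x / k| ^ p x := by positivity
        have hB : 0 ≤ |v x / l| ^ q x := by positivity
        rw [← ENNReal.ofReal_add hA hB, ← ENNReal.ofReal_mul hk.le,
          ← ENNReal.ofReal_mul (by positivity)]
        refine ENNReal.ofReal_le_ofReal ?_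
        have huv : |u x * v x| = k * l * (|u x / k| * |v x / l|) := by
          rw [abs_mul, abs_div, abs_div, abs_of_pos hk, abs_of_pos hl]
          field_simp
        rw [huv]
        gcongr
        exact (Real.young_inequality_of_nonneg (abs_nonneg _) (abs_nonneg _) hx).trans
          (add_le_add (div_le_self hA hx.lt.le) (div_le_self hB hx.symm.lt.le))
    _ = ENNReal.ofReal k * ENNReal.ofReal l *
          (modular m p (fun x => u x / k) + modular m q (fun x => v x / l)) := by
        rw [lintegral_const_mul' _ _ (by finiteness), lintegral_add_left hmeas]
        rfl
    _ ≤ ENNReal.ofReal k * ENNReal.ofReal l * 2 := by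
        rw [← one_add_one_eq_two]
        gcongr

theorem holder_inequality_variable_exponent
    {Ω : Type*} [MeasurableSpace Ω] (m : Measure Ω)
    (p : Ω → ℝ) (hp : Measurable p)
    (pm pp : ℝ) (hpm : 1 < pm)
    (hpae : ∀ᵐ x ∂m, pm ≤ p x ∧ p x ≤ pp)
    (u v : Ω → ℝ) (hu : Measurable u) (hv : Measurable v) :
    (∫⁻ x, ENNReal.ofReal |u x * v x| ∂m) ≤
      2 * luxNorm m p u * luxNorm m (fun x => p x / (p x - 1)) v := by
  have hpq : ∀ᵐ x ∂m, (p x).HolderConjugate (p x / (p x - 1)) := by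
    filter_upwards [hpae] with x hx
    exact Real.HolderConjugate.conjExponent (hpm.trans_le hx.1)
  have hq : Measurable fun x => p x / (p x - 1) := hp.div (hp.sub_const 1)
  have of_ae_zero (h : ∀ᵐ x ∂m, u x * v x = 0) :
      ∫⁻ x, ENNReal.ofReal |u x * v x| ∂m = 0 := by
    rw [lintegral_congr_ae (g := fun _ => 0) (by filter_upwards [h] with x hx; simp [hx])]
    simp
  by_cases hu0 : luxNorm m p u = 0
  · rw [of_ae_zero]
    · exact zero_le
    filter_upwards [ae_eq_zero_of_luxNorm_eq_zero hp hu (hpq.mono fun x hx => hx.lt.le) hu0]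
      with x hx
    simp [hx]
  by_cases hv0 : luxNorm m (fun x => p x / (p x - 1)) v = 0
  · rw [of_ae_zero]
    · exact zero_le
    filter_upwards [ae_eq_zero_of_luxNorm_eq_zero hq hv (hpq.mono fun x hx => hx.symm.lt.le) hv0]
      with x hx
    simp [hx]
  rw [mul_assoc, mul_comm, ← ENNReal.div_le_iff two_ne_zero ENNReal.ofNat_ne_top]
  refine ENNReal.le_mul_of_forall_lt (.inl hu0) (.inr hv0) fun a ha b hb => ?_
  obtain ⟨k, hk, hka, hku⟩ := exists_modular_le_one_of_luxNorm_lt ha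
  obtain ⟨l, hl, hlb, hlv⟩ := exists_modular_le_one_of_luxNorm_lt hb
  rw [ENNReal.div_le_iff two_ne_zero ENNReal.ofNat_ne_top]
  calc _ ≤ ENNReal.ofReal k * ENNReal.ofReal l * 2 :=
        lintegral_abs_mul_le_of_modular_le_one hp hu hpq hk hl hku hlv
    _ ≤ a * b * 2 := by gcongr
end

section
/- Embedding of variable exponent Lebesgue spaces on a finite measure space: if 𝔪(Ω) < ∞ and p, q : Ω → ℝ are measurable with 1 ≤ p(x) ≤ q(x) for 𝔪-a.e. x ∈ Ω, then for every measurable u : Ω → ℝ one has ‖u‖_{p(·)} ≤ (1 + 𝔪(Ω)) ‖u‖_{q(·)} (an inequality in [0, +∞]); in particular, if ρ_{q(·)}(u) < ∞ then u belongs to L^{p(·)}(Ω), i.e. ρ_{p(·)}(u/λ) ≤ 1 for some λ > 0. -/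
open MeasureTheory Filter Topology
open scoped ENNReal NNReal

/-- Raising the exponent on a finite measure space costs at most the total mass. -/
theorem modular_le_measure_univ_add_modular {Ω : Type*} [MeasurableSpace Ω] {m : Measure Ω}
    {p q : Ω → ℝ} (hpq : ∀ᵐ x ∂m, 0 ≤ p x ∧ p x ≤ q x) (u : Ω → ℝ) :
    modular m p u ≤ m Set.univ + modular m q u := by
  calc modular m p u
      ≤ ∫⁻ x, (1 + ENNReal.ofReal (|u x| ^ q x)) ∂m := by
        refine lintegral_mono_ae ?_
        filter_upwards [hpq] with x ⟨hp, hpq⟩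
        rcases le_total |u x| 1 with h | h
        · refine le_add_right ?_
          rw [ENNReal.ofReal_le_one]
          exact Real.rpow_le_one (abs_nonneg _) h hp
        · exact le_add_left
            (ENNReal.ofReal_le_ofReal (Real.rpow_le_rpow_of_exponent_le h hpq))
    _ = m Set.univ + modular m q u := by
        rw [lintegral_add_left measurable_const, lintegral_one, modular]

/-- Dividing by a bound `C ≥ 1` of the modular brings the modular below one. -/
theorem modular_div_le_one {Ω : Type*} [MeasurableSpace Ω] {m : Measure Ω}
    {p : Ω → ℝ} (hp : ∀ᵐ x ∂m, 1 ≤ p x) {u : Ω → ℝ} {C : ℝ} (hC : 1 ≤ C)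
    (hu : modular m p u ≤ ENNReal.ofReal C) :
    modular m p (fun x => u x / C) ≤ 1 := by
  have hC0 : 0 < C := one_pos.trans_le hC
  calc modular m p (fun x => u x / C)
      ≤ ∫⁻ x, ENNReal.ofReal C⁻¹ * ENNReal.ofReal (|u x| ^ p x) ∂m := by
        refine lintegral_mono_ae ?_
        filter_upwards [hp] with x hx
        rw [← ENNReal.ofReal_mul (inv_nonneg.2 hC0.le), abs_div, abs_of_pos hC0,
          Real.div_rpow (abs_nonneg _) hC0.le, div_eq_inv_mul]
        gcongr
        exact Real.self_le_rpow_of_one_le hC hx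
    _ = ENNReal.ofReal C⁻¹ * modular m p u :=
        lintegral_const_mul' _ _ ENNReal.ofReal_ne_top
    _ ≤ ENNReal.ofReal C⁻¹ * ENNReal.ofReal C := by gcongr
    _ = 1 := by
        rw [← ENNReal.ofReal_mul (inv_nonneg.2 hC0.le), inv_mul_cancel₀ hC0.ne',
          ENNReal.ofReal_one]

theorem luxNorm_embedding_of_exponent_le
    {Ω : Type*} [MeasurableSpace Ω] (m : Measure Ω) [IsFiniteMeasure m]
    (p q : Ω → ℝ) (hp : Measurable p) (hq : Measurable q)
    (hpq : ∀ᵐ x ∂m, 1 ≤ p x ∧ p x ≤ q x)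
    (u : Ω → ℝ) (hu : Measurable u) :
    luxNorm m p u ≤ (1 + m Set.univ) * luxNorm m q u ∧
      (modular m q u < ⊤ → ∃ l : ℝ, 0 < l ∧ modular m p (fun x => u x / l) ≤ 1) := by
  have hp1 : ∀ᵐ x ∂m, 1 ≤ p x := hpq.mono fun x hx => hx.1
  have hpq0 : ∀ᵐ x ∂m, 0 ≤ p x ∧ p x ≤ q x :=
    hpq.mono fun x hx => ⟨zero_le_one.trans hx.1, hx.2⟩
  have hM : ENNReal.ofReal (1 + m.real Set.univ) = 1 + m Set.univ := by
    rw [ENNReal.ofReal_add zero_le_one measureReal_nonneg, ENNReal.ofReal_one,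
      ofReal_measureReal]
  have hM1 : 1 ≤ 1 + m.real Set.univ := le_add_of_nonneg_right measureReal_nonneg
  constructor
  · rw [luxNorm, luxNorm, sInf_image, sInf_image,
      ENNReal.mul_iInf_of_ne (by simp) (by simp)]
    refine le_iInf fun l => ?_
    rw [ENNReal.mul_iInf_of_ne (by simp) (by simp)]
    refine le_iInf fun ⟨hl, hlu⟩ => ?_
    rw [← hM, ← ENNReal.ofReal_mul (zero_le_one.trans hM1)]
    refine iInf₂_le_of_le _ ⟨mul_pos (one_pos.trans_le hM1) hl, ?_⟩ le_rfl
    simp_rw [mul_comm _ l, ← div_div]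
    refine modular_div_le_one hp1 hM1 ?_
    rw [hM, add_comm]
    exact (modular_le_measure_univ_add_modular hpq0 _).trans (by gcongr)
  · intro hfin
    have hK : 1 ≤ 1 + m.real Set.univ + (modular m q u).toReal :=
      le_add_of_le_of_nonneg hM1 ENNReal.toReal_nonneg
    refine ⟨_, one_pos.trans_le hK, modular_div_le_one hp1 hK ?_⟩
    rw [ENNReal.ofReal_add (zero_le_one.trans hM1) ENNReal.toReal_nonneg, hM,
      ENNReal.ofReal_toReal hfin.ne, add_assoc]
    exact le_add_left (modular_le_measure_univ_add_modular hpq0 u)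
end

section
/- Let X be a reflexive real Banach space, Y a real normed space, and T : X → Y a compact linear operator (T is continuous linear and maps bounded sets to relatively compact sets). Let (e_j^*)_{j∈ℕ} be a sequence of continuous linear functionals on X that separates points (if e_j^*(u) = 0 for all j, then u = 0), and let (Z_k)_{k∈ℕ} be a decreasing sequence of closed subspaces of X such that e_j^*(u) = 0 whenever u ∈ Z_k and j < k. Then β_k := sup{‖T u‖_Y : u ∈ Z_k, ‖u‖_X ≤ 1} → 0 as k → ∞. -/
open Filter Topology

/-- In a reflexive space, a bounded family converges weakly along any ultrafilter. -/
theorem exists_weak_limit_of_reflexive {X ι : Type*} [NormedAddCommGroup X] [NormedSpace ℝ X]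
    (hrefl : Function.Surjective (NormedSpace.inclusionInDoubleDual ℝ X))
    (U : Ultrafilter ι) (u : ι → X) {C : ℝ} (hu : ∀ i, ‖u i‖ ≤ C) :
    ∃ x : X, ∀ f : X →L[ℝ] ℝ, Tendsto (fun i => f (u i)) U (𝓝 (f x)) := by
  let J : ι → WeakDual ℝ (StrongDual ℝ X) := fun i =>
    StrongDual.toWeakDual (NormedSpace.inclusionInDoubleDual ℝ X (u i))
  have hJ : ∀ i, J i ∈ WeakDual.toStrongDual ⁻¹'
      Metric.closedBall (0 : StrongDual ℝ (StrongDual ℝ X)) C := fun i =>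
    (mem_closedBall_zero_iff (a := NormedSpace.inclusionInDoubleDual ℝ X (u i))).2
      ((NormedSpace.double_dual_bound ℝ X (u i)).trans (hu i))
  obtain ⟨φ, -, hφ⟩ := (WeakDual.isCompact_closedBall
    (0 : StrongDual ℝ (StrongDual ℝ X)) C).ultrafilter_le_nhds (U.map J)
    (le_principal_iff.2 (mem_map.2 (univ_mem' hJ)))
  obtain ⟨x, hx⟩ := hrefl (WeakDual.toStrongDual φ)
  refine ⟨x, fun f => ?_⟩
  have hfx : f x = φ f := DFunLike.congr_fun hx f
  rw [hfx]
  exact ((WeakDual.eval_continuous f).tendsto φ).comp hφ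

/-- A compact operator on a reflexive space maps a bounded sequence on which each member of a
separating family of functionals tends to zero to a norm-null sequence. -/
theorem tendsto_zero_of_compact_of_separating {X Y ι κ : Type*}
    [NormedAddCommGroup X] [NormedSpace ℝ X] [NormedAddCommGroup Y] [NormedSpace ℝ Y]
    (hrefl : Function.Surjective (NormedSpace.inclusionInDoubleDual ℝ X))
    (T : X →L[ℝ] Y)
    (hT : ∀ s : Set X, Bornology.IsBounded s → IsCompact (closure (T '' s)))
    (e : κ → X →L[ℝ] ℝ) (hsep : ∀ u : X, (∀ j, e j u = 0) → u = 0)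
    {l : Filter ι} {u : ι → X} {C : ℝ} (hu : ∀ i, ‖u i‖ ≤ C)
    (he : ∀ j, Tendsto (fun i => e j (u i)) l (𝓝 0)) :
    Tendsto (fun i => T (u i)) l (𝓝 0) := by
  rw [tendsto_iff_ultrafilter]
  intro U hU
  obtain ⟨x, hx⟩ := exists_weak_limit_of_reflexive hrefl U u hu
  obtain rfl : x = 0 := hsep x fun j => tendsto_nhds_unique (hx (e j)) ((he j).mono_left hU)
  obtain ⟨y, -, hy⟩ := (hT _ (Metric.isBounded_closedBall (x := 0) (r := C))).ultrafilter_le_nhds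
    (U.map fun i => T (u i)) (le_principal_iff.2 (mem_map.2 (univ_mem' fun i =>
      subset_closure ⟨u i, mem_closedBall_zero_iff.2 (hu i), rfl⟩)))
  have hy' : Tendsto (fun i => T (u i)) U (𝓝 y) := hy
  obtain rfl : y = 0 := SeparatingDual.eq_zero_of_forall_dual_eq_zero (R := ℝ) fun g => by
    simpa using tendsto_nhds_unique ((g.continuous.tendsto y).comp hy') (hx (g.comp T))
  exact hy'

theorem sup_norm_compact_operator_tendsto_zero
    {X Y : Type*} [NormedAddCommGroup X] [NormedSpace ℝ X] [CompleteSpace X]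
    [NormedAddCommGroup Y] [NormedSpace ℝ Y]
    (hrefl : Function.Surjective (NormedSpace.inclusionInDoubleDual ℝ X))
    (T : X →L[ℝ] Y)
    (hT : ∀ s : Set X, Bornology.IsBounded s → IsCompact (closure (T '' s)))
    (e : ℕ → X →L[ℝ] ℝ)
    (hsep : ∀ u : X, (∀ j, e j u = 0) → u = 0)
    (Z : ℕ → Submodule ℝ X)
    (hZclosed : ∀ k, IsClosed (Z k : Set X))
    (hZdec : ∀ k, Z (k + 1) ≤ Z k)
    (hZe : ∀ k j, j < k → ∀ u ∈ Z k, e j u = 0) :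
    Tendsto (fun k => sSup {r : ℝ | ∃ u ∈ Z k, ‖u‖ ≤ 1 ∧ r = ‖T u‖}) atTop (𝓝 0) := by
  have key : ∀ k : ℕ, ∃ u ∈ Z k, ‖u‖ ≤ 1 ∧
      sSup {r : ℝ | ∃ u ∈ Z k, ‖u‖ ≤ 1 ∧ r = ‖T u‖} ≤ ‖T u‖ + 1 / ((k : ℝ) + 1) := by
    intro k
    obtain ⟨-, ⟨u, huZ, hu, rfl⟩, h⟩ := exists_lt_of_lt_csSup
      (s := {r : ℝ | ∃ u ∈ Z k, ‖u‖ ≤ 1 ∧ r = ‖T u‖}) ⟨_, 0, (Z k).zero_mem, by simp, rfl⟩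
      (sub_lt_self _ (Nat.one_div_pos_of_nat (α := ℝ) (n := k)))
    exact ⟨u, huZ, hu, (sub_lt_iff_lt_add.1 h).le⟩
  choose u huZ hu hle using key
  have hlim : Tendsto (fun k => T (u k)) atTop (𝓝 0) :=
    tendsto_zero_of_compact_of_separating hrefl T hT e hsep hu fun j =>
      tendsto_const_nhds.congr' <| (eventually_gt_atTop j).mono fun k hk =>
        (hZe k j hk (u k) (huZ k)).symm
  refine squeeze_zero (fun k => Real.sSup_nonneg ?_) hle ?_
  · rintro - ⟨v, -, -, rfl⟩
    exact norm_nonneg _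
  · simpa using hlim.norm.add (tendsto_one_div_add_atTop_nhds_zero_nat (𝕜 := ℝ))
end

section
/- Let X be a reflexive real Banach space, let (e_j^*)_{j∈ℕ} be a sequence of continuous linear functionals on X that separates points (if e_j^*(u) = 0 for all j, then u = 0), and let (Z_k)_{k∈ℕ} be a decreasing sequence of closed subspaces of X such that e_j^*(u) = 0 whenever u ∈ Z_k and j < k. If (u_k)_{k∈ℕ} is a bounded sequence in X with u_k ∈ Z_k for every k, then u_k converges weakly to 0, i.e. φ(u_k) → 0 for every continuous linear functional φ on X. -/
open Filter Topology

/-- In a reflexive space, a family of functionals that separates points spans a dense subspace of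
the dual. -/
theorem topologicalClosure_span_range_eq_top_of_separates
    {X ι : Type*} [NormedAddCommGroup X] [NormedSpace ℝ X]
    (hrefl : Function.Surjective (NormedSpace.inclusionInDoubleDual ℝ X))
    (e : ι → StrongDual ℝ X) (hsep : ∀ u : X, (∀ j, e j u = 0) → u = 0) :
    (Submodule.span ℝ (Set.range e)).topologicalClosure = ⊤ := by
  set S := (Submodule.span ℝ (Set.range e)).topologicalClosure
  rw [Submodule.eq_top_iff']
  intro φ
  by_contra hφ
  obtain ⟨f, c, hfS, hfφ⟩ := geometric_hahn_banach_closed_point S.convex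
    (Submodule.isClosed_topologicalClosure _) hφ
  obtain ⟨x, rfl⟩ := hrefl f
  have hx : x = 0 := by
    refine hsep x fun j => ?_
    by_contra hj
    have hjS : e j ∈ S :=
      Submodule.le_topologicalClosure _ (Submodule.subset_span (Set.mem_range_self j))
    have h := hfS _ (S.smul_mem (c / e j x) hjS)
    simp [hj] at h
  have h := hfS 0 S.zero_mem
  simp only [hx, map_zero, zero_apply] at h hfφ
  exact lt_asymm h hfφ

/-- The functionals that tend to zero along a bounded family form a closed set. -/
theorem isClosed_setOf_tendsto_apply_zero
    {X ι : Type*} [NormedAddCommGroup X] [NormedSpace ℝ X] (l : Filter ι) {u : ι → X} {C : ℝ}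
    (hC : ∀ k, ‖u k‖ ≤ C) :
    IsClosed {φ : StrongDual ℝ X | Tendsto (fun k => φ (u k)) l (𝓝 0)} := by
  have hlip (k : ι) : LipschitzWith C.toNNReal (fun φ : StrongDual ℝ X => φ (u k)) := by
    refine LipschitzWith.of_dist_le_mul fun φ ψ => ?_
    rw [dist_eq_norm, dist_eq_norm, ← sub_apply, mul_comm]
    exact (φ - ψ).le_opNorm_of_le ((hC k).trans (Real.le_coe_toNNReal C))
  exact (LipschitzWith.uniformEquicontinuous _ _ hlip).equicontinuous.isClosed_setOfPred_tendsto
    continuous_const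

theorem weak_convergence_to_zero_of_tail_subspaces
    {X : Type*} [NormedAddCommGroup X] [NormedSpace ℝ X] [CompleteSpace X]
    (hrefl : Function.Surjective (NormedSpace.inclusionInDoubleDual ℝ X))
    (e : ℕ → X →L[ℝ] ℝ)
    (hsep : ∀ u : X, (∀ j, e j u = 0) → u = 0)
    (Z : ℕ → Submodule ℝ X)
    (hZclosed : ∀ k, IsClosed (Z k : Set X))
    (hZdec : ∀ k, Z (k + 1) ≤ Z k)
    (hZe : ∀ k j, j < k → ∀ u ∈ Z k, e j u = 0)
    (u : ℕ → X) (hu : ∀ k, u k ∈ Z k)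
    (hbdd : ∃ C : ℝ, ∀ k, ‖u k‖ ≤ C) :
    ∀ φ : X →L[ℝ] ℝ, Tendsto (fun k => φ (u k)) atTop (𝓝 0) := by
  obtain ⟨C, hC⟩ := hbdd
  intro φ
  have hspan : (Submodule.span ℝ (Set.range e) : Set (StrongDual ℝ X)) ⊆
      {ψ | Tendsto (fun k => ψ (u k)) atTop (𝓝 0)} := by
    intro ψ hψ
    induction hψ using Submodule.span_induction with
    | mem ψ h =>
      obtain ⟨j, rfl⟩ := h
      refine tendsto_const_nhds.congr' ?_
      filter_upwards [eventually_gt_atTop j] with k hk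
      exact (hZe k j hk (u k) (hu k)).symm
    | zero => simp
    | add ψ χ _ _ hψ hχ => simpa using Tendsto.add hψ hχ
    | smul a ψ _ hψ => simpa using Tendsto.const_mul a hψ
  have hφ : φ ∈ (Submodule.span ℝ (Set.range e)).topologicalClosure := by
    rw [topologicalClosure_span_range_eq_top_of_separates hrefl e hsep]
    exact Submodule.mem_top
  exact closure_minimal hspan (isClosed_setOf_tendsto_apply_zero atTop hC) hφ
end

section
/- Fountain theorem: let X, (e_j), Y_k, Z_k be as in the context and let I : X → ℝ be a C¹ even functional (I(−u) = I(u) for all u). Suppose that for each k ∈ ℕ there exist ρ_k > r_k > 0 such that: (A1) inf{I(u) : u ∈ Z_k, ‖u‖ = r_k} → +∞ as k → ∞; (A2) max{I(u) : u ∈ Y_k, ‖u‖ = ρ_k} ≤ 0; (A3) I satisfies the (PS)_c condition for every c > 0. Then I has an unbounded sequence of critical points: there exists a sequence (u_k) in X with I'(u_k) = 0 for every k and I(u_k) → +∞. -/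
open Filter Topology

/-- `w` is obtained from `v` by moving a single even coordinate by `±1`. -/
def FlagStep (v w : ℕ → ℤ) : Prop :=
  ∃ a, Even (v a) ∧ (w a = v a + 1 ∨ w a = v a - 1) ∧ ∀ i, i ≠ a → w i = v i

/-- Maximal flags of faces in the tiling of `ℝ^m` by the cubes with even integer vertices. A face
is encoded by its barycentre, an integer point whose odd coordinates are the directions of the
face. -/
structure IsFlag (m : ℕ) (σ : ℕ → ℕ → ℤ) : Prop where
  even_zero : ∀ i, Even (σ 0 i)
  odd_top : ∀ i < m, Odd (σ m i)
  zero_coord : ∀ j ≤ m, ∀ i, m ≤ i → σ j i = 0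
  zero_above : ∀ j, m < j → σ j = 0
  step : ∀ j < m, FlagStep (σ j) (σ (j + 1))

/-- Omit the vertex of index `j` from a sequence. -/
def faceMap {α : Type*} (j : ℕ) (σ : ℕ → α) : ℕ → α := fun i => if i < j then σ i else σ (i + 1)

/-- The cup product of the coboundaries of the `0`-cochains `s 0, …, s (k - 1)`. -/
def cupCobdry {α : Type*} (s : ℕ → α → ZMod 2) (k : ℕ) (u : ℕ → α) : ZMod 2 :=
  ∏ i ∈ Finset.range k, (s i (u i) + s i (u (i + 1)))

section cochains

variable {α : Type*} (s : ℕ → α → ZMod 2)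

lemma cupCobdry_succ (k : ℕ) (u : ℕ → α) :
    cupCobdry s (k + 1) u = cupCobdry s k u * (s k (u k) + s k (u (k + 1))) :=
  Finset.prod_range_succ _ _

lemma cupCobdry_congr {k : ℕ} {u w : ℕ → α} (h : ∀ i ≤ k, u i = w i) :
    cupCobdry s k u = cupCobdry s k w := by
  refine Finset.prod_congr rfl fun i hi => ?_
  have := Finset.mem_range.1 hi
  rw [h i (by omega), h (i + 1) (by omega)]

lemma cupCobdry_faceMap_top (k : ℕ) (σ : ℕ → α) :
    cupCobdry s k (faceMap (k + 1) σ) = cupCobdry s k σ :=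
  cupCobdry_congr s fun i hi => by simp [faceMap, Nat.lt_succ_of_le hi]

lemma sum_cupCobdry_faceMap_mul_of_sum {k : ℕ} {σ : ℕ → α}
    (h : ∑ j ∈ Finset.range (k + 1), cupCobdry s k (faceMap j σ) = cupCobdry s k σ)
    (g : α → ZMod 2) :
    ∑ j ∈ Finset.range (k + 2), cupCobdry s k (faceMap j σ) * g (faceMap j σ k) =
      cupCobdry s k σ * (g (σ k) + g (σ (k + 1))) := by
  rw [Finset.sum_range_succ, cupCobdry_faceMap_top]
  have : ∀ j ∈ Finset.range (k + 1), cupCobdry s k (faceMap j σ) * g (faceMap j σ k) =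
      cupCobdry s k (faceMap j σ) * g (σ (k + 1)) := by
    intro j hj
    have := Finset.mem_range.1 hj
    simp [faceMap, show ¬ k < j by omega]
  rw [Finset.sum_congr rfl this, ← Finset.sum_mul, h]
  simp [faceMap]
  ring

lemma sum_cupCobdry_faceMap (k : ℕ) (σ : ℕ → α) :
    ∑ j ∈ Finset.range (k + 1), cupCobdry s k (faceMap j σ) = cupCobdry s k σ := by
  induction k with
  | zero => simp [cupCobdry]
  | succ k ih =>
    have h1 := sum_cupCobdry_faceMap_mul_of_sum s ih (s k)
    have h2 : ∀ j ∈ Finset.range (k + 2), cupCobdry s (k + 1) (faceMap j σ) =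
        cupCobdry s k (faceMap j σ) * s k (faceMap j σ k) +
        cupCobdry s k (faceMap j σ) * s k (σ (k + 2)) := by
      intro j hj
      have := Finset.mem_range.1 hj
      rw [cupCobdry_succ, mul_add]
      simp [faceMap, show ¬ k + 1 < j by omega]
    rw [Finset.sum_congr rfl h2, Finset.sum_add_distrib, h1, ← Finset.sum_mul,
      Finset.sum_range_succ, ih, cupCobdry_faceMap_top, CharTwo.add_self_eq_zero, zero_mul,
      add_zero, cupCobdry_succ]

/-- The Leibniz rule for `δ (δ s₀ ∪ ⋯ ∪ δ sₖ₋₁ ∪ g)`. -/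
lemma sum_cupCobdry_faceMap_mul (k : ℕ) (σ : ℕ → α) (g : α → ZMod 2) :
    ∑ j ∈ Finset.range (k + 2), cupCobdry s k (faceMap j σ) * g (faceMap j σ k) =
      cupCobdry s k σ * (g (σ k) + g (σ (k + 1))) :=
  sum_cupCobdry_faceMap_mul_of_sum s (sum_cupCobdry_faceMap s k σ) g

end cochains

lemma faceMap_update {α : Type*} (j : ℕ) (σ : ℕ → α) (x : α) :
    faceMap j (Function.update σ j x) = faceMap j σ := by
  funext i
  unfold faceMap
  split_ifs with h
  · rw [Function.update_of_ne (by omega)]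
  · rw [Function.update_of_ne (by omega)]

/-- The flag adjacent to `σ` along the face omitting the vertex of index `j`. -/
def adjFlag (m j : ℕ) (σ : ℕ → ℕ → ℤ) : ℕ → ℕ → ℤ :=
  Function.update σ j
    (σ (if j = 0 then 1 else j - 1) + σ (if j = m then m - 1 else j + 1) - σ j)

lemma faceMap_adjFlag (m j : ℕ) (σ : ℕ → ℕ → ℤ) : faceMap j (adjFlag m j σ) = faceMap j σ :=
  faceMap_update _ _ _

lemma adjFlag_of_ne {m j l : ℕ} (σ : ℕ → ℕ → ℤ) (h : l ≠ j) : adjFlag m j σ l = σ l :=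
  Function.update_of_ne h _ _

lemma adjFlag_self (m j : ℕ) (σ : ℕ → ℕ → ℤ) : adjFlag m j σ j =
    σ (if j = 0 then 1 else j - 1) + σ (if j = m then m - 1 else j + 1) - σ j :=
  Function.update_self _ _ _

lemma adjFlag_adjFlag {m j : ℕ} (hm : m ≠ 0) (σ : ℕ → ℕ → ℤ) :
    adjFlag m j (adjFlag m j σ) = σ := by
  funext l
  by_cases h : l = j
  · subst h
    rw [adjFlag_self, adjFlag_of_ne (l := if l = 0 then 1 else l - 1),
      adjFlag_of_ne (l := if l = m then m - 1 else l + 1), adjFlag_self]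
    · abel
    · split_ifs <;> omega
    · split_ifs <;> omega
  · rw [adjFlag_of_ne _ h, adjFlag_of_ne _ h]

lemma FlagStep.ne_zero {v w : ℕ → ℤ} (h : FlagStep v w) : w ≠ 0 := by
  rintro rfl
  obtain ⟨a, ⟨b, hb⟩, h1, -⟩ := h
  simp at h1
  omega

lemma FlagStep.eq_of_odd {v w : ℕ → ℤ} (h : FlagStep v w) {i : ℕ} (hi : Odd (v i)) :
    w i = v i := by
  obtain ⟨a, ⟨b, hb⟩, h1, h2⟩ := h
  refine h2 i ?_
  rintro rfl
  obtain ⟨c, hc⟩ := hi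
  omega

lemma FlagStep.neg {v w : ℕ → ℤ} (h : FlagStep v w) : FlagStep (-v) (-w) := by
  obtain ⟨a, h0, h1, h2⟩ := h
  refine ⟨a, by simpa using h0, ?_, fun i hi => by simp [h2 i hi]⟩
  simp only [Pi.neg_apply]
  omega

/-- The two ways of completing `v < · < w` in the face poset. -/
lemma FlagStep.swap {u v w : ℕ → ℤ} (h : FlagStep u v) (h' : FlagStep v w) :
    FlagStep u (u + w - v) ∧ FlagStep (u + w - v) w ∧ u + w - v ≠ v := by
  obtain ⟨a, ⟨c, hc⟩, h1, h2⟩ := h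
  obtain ⟨b, ⟨d, hd⟩, h3, h4⟩ := h'
  have hab : a ≠ b := by rintro rfl; omega
  have ea := h4 a hab
  have eb := h2 b hab.symm
  refine ⟨⟨b, ⟨d, by omega⟩, ?_, fun i hi => ?_⟩, ⟨a, ⟨c, ?_⟩, ?_, fun i hi => ?_⟩, fun h => ?_⟩
  · simp only [Pi.sub_apply, Pi.add_apply]; omega
  · simp only [Pi.sub_apply, Pi.add_apply]; have := h4 i hi; omega
  · simp only [Pi.sub_apply, Pi.add_apply]; omega
  · simp only [Pi.sub_apply, Pi.add_apply]; omega
  · simp only [Pi.sub_apply, Pi.add_apply]; have := h2 i hi; omega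
  · have := congrFun h b
    simp only [Pi.sub_apply, Pi.add_apply] at this; omega

lemma FlagStep.reflect_left {v w : ℕ → ℤ} (h : FlagStep v w) :
    FlagStep (w + w - v) w ∧ w + w - v ≠ v ∧ ∀ i, Even (v i) → Even ((w + w - v) i) := by
  obtain ⟨a, ⟨b, hb⟩, h1, h2⟩ := h
  refine ⟨⟨a, ?_, ?_, fun i hi => ?_⟩, fun h => ?_, fun i hi => ?_⟩
  · exact ⟨w a - b, by simp only [Pi.sub_apply, Pi.add_apply]; omega⟩
  · simp only [Pi.sub_apply, Pi.add_apply]; omega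
  · simp only [Pi.sub_apply, Pi.add_apply]; have := h2 i hi; omega
  · have := congrFun h a
    simp only [Pi.sub_apply, Pi.add_apply] at this; omega
  · obtain ⟨c, hc⟩ := hi
    exact ⟨w i - c, by simp only [Pi.sub_apply, Pi.add_apply]; omega⟩

lemma FlagStep.reflect_right {v w : ℕ → ℤ} (h : FlagStep v w) :
    FlagStep v (v + v - w) ∧ v + v - w ≠ w ∧ ∀ i, Odd (w i) → Odd ((v + v - w) i) := by
  obtain ⟨a, ⟨b, hb⟩, h1, h2⟩ := h
  refine ⟨⟨a, ⟨b, hb⟩, ?_, fun i hi => ?_⟩, fun h => ?_, fun i hi => ?_⟩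
  · simp only [Pi.sub_apply, Pi.add_apply]; omega
  · simp only [Pi.sub_apply, Pi.add_apply]; have := h2 i hi; omega
  · have := congrFun h a
    simp only [Pi.sub_apply, Pi.add_apply] at this; omega
  · obtain ⟨c, hc⟩ := hi
    exact ⟨v i - c - 1, by simp only [Pi.sub_apply, Pi.add_apply]; omega⟩

namespace IsFlag

variable {m : ℕ} {σ : ℕ → ℕ → ℤ}

lemma neg (h : IsFlag m σ) : IsFlag m (-σ) where
  even_zero i := by simpa using h.even_zero i
  odd_top i hi := by simpa using h.odd_top i hi
  zero_coord j hj i hi := by simpa using h.zero_coord j hj i hi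
  zero_above j hj := by simpa using h.zero_above j hj
  step j hj := (h.step j hj).neg

lemma eq_or_odd (h : IsFlag m σ) {j l : ℕ} (hjl : j ≤ l) (hl : l ≤ m) (i : ℕ) :
    σ l i = σ j i ∨ (Odd (σ l i) ∧ (σ l i = σ j i + 1 ∨ σ l i = σ j i - 1)) := by
  induction l, hjl using Nat.le_induction with
  | base => exact Or.inl rfl
  | succ l hjl ih =>
    have hs := h.step l (by omega)
    rcases ih (by omega) with h1 | ⟨h1, h2⟩
    · obtain ⟨a, ⟨b, hb⟩, h3, h4⟩ := hs
      by_cases hi : i = a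
      · subst hi
        refine Or.inr ⟨?_, by omega⟩
        rcases h3 with h3 | h3
        · exact ⟨b, by omega⟩
        · exact ⟨b - 1, by omega⟩
      · exact Or.inl (by rw [h4 i hi, h1])
    · rw [hs.eq_of_odd h1]
      exact Or.inr ⟨h1, h2⟩

lemma abs_sub_le (h : IsFlag m σ) {j l : ℕ} (hj : j ≤ m) (hl : l ≤ m) (i : ℕ) :
    |σ l i - σ j i| ≤ 1 := by
  rw [abs_le]
  rcases le_total j l with hjl | hjl
  · rcases h.eq_or_odd hjl hl i with h1 | ⟨-, h1⟩ <;> omega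
  · rcases h.eq_or_odd hjl hj i with h1 | ⟨-, h1⟩ <;> omega

lemma ne_zero_of_pos (h : IsFlag m σ) {j : ℕ} (hj : j < m) : σ (j + 1) ≠ 0 :=
  (h.step j hj).ne_zero

lemma adjFlag_ne_and (h : IsFlag m σ) (hm : m ≠ 0) {j : ℕ} (hj : j ≤ m) :
    adjFlag m j σ ≠ σ ∧ IsFlag m (adjFlag m j σ) := by
  have hzero : ∀ i, m ≤ i → adjFlag m j σ j i = 0 := by
    intro i hi
    rw [adjFlag_self]
    simp only [Pi.sub_apply, Pi.add_apply]
    rw [h.zero_coord _ _ i hi, h.zero_coord _ _ i hi, h.zero_coord _ hj i hi]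
    · rfl
    · split_ifs <;> omega
    · split_ifs <;> omega
  have key : adjFlag m j σ j ≠ σ j ∧ (j = 0 → ∀ i, Even (adjFlag m j σ j i)) ∧
      (j = m → ∀ i < m, Odd (adjFlag m j σ j i)) ∧
      (∀ l, l + 1 = j → FlagStep (σ l) (adjFlag m j σ j)) ∧
      (j < m → FlagStep (adjFlag m j σ j) (σ (j + 1))) := by
    rw [adjFlag_self]
    rcases Nat.eq_zero_or_pos j with rfl | hj0
    · obtain ⟨h1, h2, h3⟩ := (h.step 0 (by omega)).reflect_left
      simp only [if_true, if_neg hm.symm]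
      exact ⟨h2, fun _ i => h3 i (h.even_zero i), fun h0 => absurd h0.symm hm,
        fun l hl => by omega, fun _ => h1⟩
    · rcases hj.eq_or_lt with rfl | hjm
      · have hs := h.step (j - 1) (by omega)
        rw [Nat.sub_add_cancel hj0] at hs
        obtain ⟨h1, h2, h3⟩ := hs.reflect_right
        simp only [if_true, if_neg hm]
        refine ⟨h2, fun h0 => by omega, fun _ i hi => h3 i (h.odd_top i hi), ?_, by omega⟩
        rintro l rfl
        exact h1
      · have hs := h.step (j - 1) (by omega)
        rw [Nat.sub_add_cancel hj0] at hs
        obtain ⟨h1, h2, h3⟩ := hs.swap (h.step j hjm)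
        simp only [if_neg hj0.ne', if_neg hjm.ne]
        refine ⟨h3, fun h0 => by omega, fun _ => by omega, ?_, fun _ => h2⟩
        rintro l rfl
        exact h1
  obtain ⟨h1, h2, h3, h4, h5⟩ := key
  refine ⟨fun he => h1 (congrFun he j), ⟨fun i => ?_, fun i hi => ?_, fun l hl i hi => ?_,
    fun l hl => ?_, fun l hl => ?_⟩⟩
  · by_cases hj0 : j = 0
    · subst hj0; exact h2 rfl i
    · rw [adjFlag_of_ne _ (Ne.symm hj0)]; exact h.even_zero i
  · by_cases hjm : j = m
    · subst hjm; exact h3 rfl i hi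
    · rw [adjFlag_of_ne _ (Ne.symm hjm)]; exact h.odd_top i hi
  · by_cases hlj : l = j
    · subst hlj; exact hzero i hi
    · rw [adjFlag_of_ne _ hlj]; exact h.zero_coord l hl i hi
  · rw [adjFlag_of_ne _ (by omega)]; exact h.zero_above l hl
  · by_cases hlj : l = j
    · subst hlj
      rw [adjFlag_of_ne (l := l + 1) _ (by omega)]
      exact h5 hl
    · rw [adjFlag_of_ne _ hlj]
      by_cases hlj' : l + 1 = j
      · subst hlj'; exact h4 l rfl
      · rw [adjFlag_of_ne _ hlj']; exact h.step l hl

end IsFlag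

lemma finite_setOf_isFlag (m : ℕ) (L : ℤ) :
    {σ : ℕ → ℕ → ℤ | IsFlag m σ ∧ ∀ j i, |σ j i| ≤ L}.Finite := by
  refine Set.Finite.of_injOn (f := fun σ (p : Fin (m + 1) × Fin m) => σ p.1 p.2)
    (t := Set.pi Set.univ fun _ => Set.Icc (-L) L) ?_ ?_
    (Set.Finite.pi fun _ => Set.finite_Icc _ _)
  · rintro σ ⟨-, h⟩ p -
    exact abs_le.1 (h _ _)
  · rintro σ ⟨h, -⟩ τ ⟨h', -⟩ he
    funext j i
    by_cases hj : j ≤ m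
    · by_cases hi : i < m
      · exact congrFun he (⟨j, by omega⟩, ⟨i, hi⟩)
      · rw [h.zero_coord j hj i (by omega), h'.zero_coord j hj i (by omega)]
    · rw [h.zero_above j (by omega), h'.zero_above j (by omega)]

/-- The flags of `ℝ^m` inside the box `[-L, L]^m`. -/
noncomputable def flagsIn (m : ℕ) (L : ℤ) : Finset (ℕ → ℕ → ℤ) :=
  (finite_setOf_isFlag m L).toFinset

lemma mem_flagsIn {m : ℕ} {L : ℤ} {σ : ℕ → ℕ → ℤ} :
    σ ∈ flagsIn m L ↔ IsFlag m σ ∧ ∀ j i, |σ j i| ≤ L := by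
  simp [flagsIn]

/-- The flags in `[-L, L]^m × [0, L]`. -/
noncomputable def halfFlagsIn (m : ℕ) (L : ℤ) : Finset (ℕ → ℕ → ℤ) :=
  (flagsIn (m + 1) L).filter fun σ => 0 < σ (m + 1) m

lemma mem_halfFlagsIn {m : ℕ} {L : ℤ} {σ : ℕ → ℕ → ℤ} :
    σ ∈ halfFlagsIn m L ↔ (IsFlag (m + 1) σ ∧ ∀ j i, |σ j i| ≤ L) ∧ 0 < σ (m + 1) m := by
  simp [halfFlagsIn, mem_flagsIn]

/-- Flags cancel in pairs along their common faces. -/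
lemma sum_faceMap_eq_zero {m : ℕ} {K : ℤ} {j : ℕ} (hj : j ≤ m + 1)
    (S : Finset (ℕ → ℕ → ℤ)) (hS : S ⊆ flagsIn (m + 1) (K + 1))
    (f : (ℕ → ℕ → ℤ) → ZMod 2)
    (hSadj : ∀ σ ∈ S, f (faceMap j σ) ≠ 0 →
      adjFlag (m + 1) j σ ∈ flagsIn (m + 1) (K + 1) → adjFlag (m + 1) j σ ∈ S)
    (hf : ∀ u, f u ≠ 0 → ∀ i ≤ m, |u m i| ≤ K) :
    ∑ σ ∈ S, f (faceMap j σ) = 0 := by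
  classical
  rw [← Finset.sum_filter_ne_zero]
  refine Finset.sum_involution (fun σ _ => adjFlag (m + 1) j σ) ?_ ?_ ?_ ?_
  · intro σ _
    rw [faceMap_adjFlag, CharTwo.add_self_eq_zero]
  · intro σ hσ _
    exact ((mem_flagsIn.1 (hS (Finset.mem_filter.1 hσ).1)).1.adjFlag_ne_and (by omega) hj).1
  · intro σ hσ
    obtain ⟨hσ, hne⟩ := Finset.mem_filter.1 hσ
    have hfl := mem_flagsIn.1 (hS hσ)
    have hadj := (hfl.1.adjFlag_ne_and (by omega) hj).2
    rw [Finset.mem_filter, faceMap_adjFlag]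
    refine ⟨hSadj σ hσ hne ?_, hne⟩
    refine mem_flagsIn.2 ⟨hadj, fun l i => ?_⟩
    by_cases hl : l = j
    · subst hl
      by_cases hi : m + 1 ≤ i
      · rw [hadj.zero_coord l hj i hi]
        exact (abs_nonneg _).trans (hfl.2 0 0)
      · have hb := hf _ hne i (by omega)
        rw [← faceMap_adjFlag (m + 1)] at hb
        unfold faceMap at hb
        split_ifs at hb with h1
        · have := hadj.abs_sub_le (j := m) (by omega) hj i
          rw [abs_le] at *
          omega
        · have := hadj.abs_sub_le (j := m + 1) (by omega) hj i
          rw [abs_le] at *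
          omega
    · rw [adjFlag_of_ne _ hl]; exact hfl.2 l i
  · intro σ _
    exact adjFlag_adjFlag (by omega) σ

/-- The flags of the half space meeting the boundary hyperplane in a face are the flags of this
hyperplane. -/
lemma sum_halfFlagsIn_filter {m : ℕ} {L : ℤ} (hL : 1 ≤ L) (f : (ℕ → ℕ → ℤ) → ZMod 2)
    (hf : ∀ u w, (∀ i ≤ m, u i = w i) → f u = f w) :
    ∑ σ ∈ (halfFlagsIn m L).filter (fun σ => σ m m = 0), f σ = ∑ τ ∈ flagsIn m L, f τ := by
  refine Finset.sum_bij' (fun σ _ => Function.update σ (m + 1) 0)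
    (fun τ _ => Function.update τ (m + 1) (Function.update (τ m) m 1)) ?_ ?_ ?_ ?_ ?_
  · intro σ hσ
    simp only [Finset.mem_filter, mem_halfFlagsIn] at hσ
    obtain ⟨⟨⟨h, hb⟩, hpos⟩, h0⟩ := hσ
    have hcol : ∀ j ≤ m, σ j m = 0 := by
      intro j hj
      rcases h.eq_or_odd hj (by omega) m with h1 | ⟨h1, -⟩
      · rw [← h1, h0]
      · rw [h0] at h1; exact absurd h1 (by decide)
    rw [mem_flagsIn]
    refine ⟨⟨fun i => ?_, fun i hi => ?_, fun j hj i hi => ?_, fun j hj => ?_, fun j hj => ?_⟩,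
      fun j i => ?_⟩
    · rw [Function.update_of_ne (by omega)]; exact h.even_zero i
    · rw [Function.update_of_ne (by omega)]
      obtain ⟨a, ha, -, h2⟩ := h.step m (by omega)
      have ham : m = a := by
        by_contra hne
        have h3 := h2 m hne
        omega
      rw [← h2 i (by omega)]
      exact h.odd_top i (by omega)
    · rw [Function.update_of_ne (by omega)]
      rcases hi.eq_or_lt with rfl | hi
      · exact hcol j hj
      · exact h.zero_coord j (by omega) i hi
    · by_cases hjm : j = m + 1
      · subst hjm; simp
      · rw [Function.update_of_ne hjm]; exact h.zero_above j (by omega)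
    · rw [Function.update_of_ne (by omega), Function.update_of_ne (by omega)]
      exact h.step j (by omega)
    · by_cases hjm : j = m + 1
      · subst hjm; simp; omega
      · rw [Function.update_of_ne hjm]; exact hb j i
  · intro τ hτ
    obtain ⟨h, hb⟩ := mem_flagsIn.1 hτ
    simp only [Finset.mem_filter, mem_halfFlagsIn]
    refine ⟨⟨⟨⟨fun i => ?_, fun i hi => ?_, fun j hj i hi => ?_, fun j hj => ?_, fun j hj => ?_⟩,
      fun j i => ?_⟩, ?_⟩, ?_⟩
    · rw [Function.update_of_ne (by omega)]; exact h.even_zero i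
    · rw [Function.update_self]
      by_cases him : i = m
      · subst him; simp
      · rw [Function.update_of_ne him]; exact h.odd_top i (by omega)
    · by_cases hjm : j = m + 1
      · subst hjm
        rw [Function.update_self, Function.update_of_ne (by omega)]
        exact h.zero_coord m le_rfl i (by omega)
      · rw [Function.update_of_ne hjm]; exact h.zero_coord j (by omega) i (by omega)
    · rw [Function.update_of_ne (by omega)]; exact h.zero_above j (by omega)
    · rw [Function.update_of_ne (by omega)]
      by_cases hjm : j = m
      · subst hjm
        rw [Function.update_self]
        have := h.zero_coord j le_rfl j le_rfl
        exact ⟨j, by simp [this], by simp [this], fun i hi => Function.update_of_ne hi _ _⟩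
      · rw [Function.update_of_ne (by omega)]; exact h.step j (by omega)
    · by_cases hjm : j = m + 1
      · subst hjm
        rw [Function.update_self]
        by_cases him : i = m
        · subst him; simpa using hL
        · rw [Function.update_of_ne him]; exact hb m i
      · rw [Function.update_of_ne hjm]; exact hb j i
    · simp
    · rw [Function.update_of_ne (by omega)]; exact h.zero_coord m le_rfl m le_rfl
  · intro σ hσ
    simp only [Finset.mem_filter, mem_halfFlagsIn] at hσ
    obtain ⟨⟨⟨h, hb⟩, hpos⟩, h0⟩ := hσ
    funext j
    by_cases hjm : j = m + 1
    · subst hjm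
      rw [Function.update_self, Function.update_of_ne (by omega)]
      obtain ⟨a, ha, h1, h2⟩ := h.step m (by omega)
      have ham : m = a := by
        by_contra hne
        have h3 := h2 m hne
        omega
      subst ham
      funext i
      by_cases him : i = m
      · subst him; rw [Function.update_self]; omega
      · rw [Function.update_of_ne him, h2 i him]
    · rw [Function.update_of_ne hjm, Function.update_of_ne hjm]
  · intro τ hτ
    obtain ⟨h, hb⟩ := mem_flagsIn.1 hτ
    rw [Function.update_idem, ← h.zero_above (m + 1) (by omega), Function.update_eq_self]
  · intro σ hσ
    exact hf _ _ fun i hi => by rw [Function.update_of_ne (by omega)]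

section labelling

variable {n : ℕ} {K : ℤ} {s : ℕ → (ℕ → ℤ) → ZMod 2} {χ : (ℕ → ℤ) → ZMod 2}

/-- Stokes' theorem in a half space. -/
lemma sum_halfFlagsIn_cupCobdry (hK : 0 ≤ K)
    (hχ : ∀ v, χ v ≠ 0 → ∀ i < n, |v i| ≤ K) {m : ℕ} (hm : m < n) :
    ∑ σ ∈ halfFlagsIn m (K + 1), cupCobdry s m σ * (χ (σ m) + χ (σ (m + 1))) =
      ∑ τ ∈ flagsIn m (K + 1), cupCobdry s m τ * χ (τ m) := by
  set f : (ℕ → ℕ → ℤ) → ZMod 2 := fun u => cupCobdry s m u * χ (u m) with hf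
  have hfK : ∀ u, f u ≠ 0 → ∀ i ≤ m, |u m i| ≤ K := fun u hu i hi =>
    hχ _ (right_ne_zero_of_mul hu) i (by omega)
  have hsub : halfFlagsIn m (K + 1) ⊆ flagsIn (m + 1) (K + 1) := Finset.filter_subset _ _
  rw [Finset.sum_congr rfl fun σ _ => (sum_cupCobdry_faceMap_mul s m σ χ).symm, Finset.sum_comm,
    Finset.sum_range_succ, Finset.sum_eq_zero, zero_add]
  · rw [← Finset.sum_filter_add_sum_filter_not _ (fun σ : ℕ → ℕ → ℤ => σ m m = 0)]
    have h0 := sum_faceMap_eq_zero (j := m + 1) le_rfl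
      ((halfFlagsIn m (K + 1)).filter fun σ => ¬ σ m m = 0)
      ((Finset.filter_subset _ _).trans hsub) f ?_ hfK
    · have h1 := sum_halfFlagsIn_filter (m := m) (L := K + 1) (by omega)
        (fun σ => f (faceMap (m + 1) σ)) ?_
      · rw [h0, add_zero, h1]
        refine Finset.sum_congr rfl fun τ _ => ?_
        simp only [hf, cupCobdry_faceMap_top]
        simp [faceMap]
      · intro u w h
        simp only [hf, cupCobdry_faceMap_top]
        rw [cupCobdry_congr s h]
        simp [faceMap, h m le_rfl]
    · intro σ hσ _ hadj
      simp only [Finset.mem_filter, mem_halfFlagsIn] at hσ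
      obtain ⟨⟨⟨h, hb⟩, hpos⟩, h0⟩ := hσ
      simp only [Finset.mem_filter, mem_halfFlagsIn]
      refine ⟨⟨mem_flagsIn.1 hadj, ?_⟩, by rwa [adjFlag_of_ne _ (by omega)]⟩
      rw [adjFlag_self]
      obtain ⟨a, ⟨b, hb⟩, h1, h2⟩ := h.step m (by omega)
      simp only [Nat.add_eq_zero_iff, one_ne_zero, and_false, if_false, if_true,
        Nat.add_sub_cancel, Pi.sub_apply, Pi.add_apply]
      by_cases ham : m = a
      · subst ham; omega
      · have := h2 m ham; omega
  · intro j hj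
    have hj := Finset.mem_range.1 hj
    refine sum_faceMap_eq_zero (K := K) (by omega) _ hsub f ?_ hfK
    intro σ hσ _ hadj
    rw [mem_halfFlagsIn] at hσ ⊢
    exact ⟨mem_flagsIn.1 hadj, by rw [adjFlag_of_ne _ (by omega)]; exact hσ.2⟩

lemma cupCobdry_neg (hs : ∀ i v, v ≠ 0 → s i (-v) = s i v + 1) {m : ℕ} {σ : ℕ → ℕ → ℤ}
    (h0 : ∀ j ≤ m, σ j ≠ 0) : cupCobdry s m (-σ) = cupCobdry s m σ := by
  refine Finset.prod_congr rfl fun i hi => ?_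
  have := Finset.mem_range.1 hi
  rw [Pi.neg_apply, Pi.neg_apply, hs i _ (h0 i (by omega)), hs i _ (h0 (i + 1) (by omega))]
  have : (1 : ZMod 2) + 1 = 0 := by decide
  linear_combination this

/-- Stokes' theorem in the whole space, using the antisymmetry of `s m` to halve the sum. -/
lemma sum_flagsIn_cupCobdry_succ
    (hs : ∀ i v, v ≠ 0 → s i (-v) = s i v + 1) (hχneg : ∀ v, χ (-v) = χ v)
    (hχ1 : ∀ v : ℕ → ℤ, (∀ i, |v i| ≤ 1) → χ v = 1)
    (hχ : ∀ v, χ v ≠ 0 → ∀ i < n, |v i| ≤ K) {m : ℕ} (hm : m < n) :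
    ∑ τ ∈ flagsIn (m + 1) (K + 1), cupCobdry s (m + 1) τ * χ (τ (m + 1)) =
      ∑ σ ∈ halfFlagsIn m (K + 1), cupCobdry s m σ * (χ (σ m) + χ (σ (m + 1))) := by
  have two : (2 : ZMod 2) = 0 := by decide
  have h0 : ∑ σ ∈ flagsIn (m + 1) (K + 1),
      cupCobdry s m σ * (s m (σ m) * χ (σ m) + s m (σ (m + 1)) * χ (σ (m + 1))) = 0 := by
    rw [Finset.sum_congr rfl fun σ _ =>
      (sum_cupCobdry_faceMap_mul s m σ fun v => s m v * χ v).symm, Finset.sum_comm]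
    refine Finset.sum_eq_zero fun j hj => ?_
    have hj := Finset.mem_range.1 hj
    refine sum_faceMap_eq_zero (K := K) (by omega) _ subset_rfl
      (fun u => cupCobdry s m u * (s m (u m) * χ (u m))) (fun _ _ _ h => h) ?_
    intro u hu i hi
    exact hχ _ (right_ne_zero_of_mul (right_ne_zero_of_mul hu)) i (by omega)
  have h1 : ∑ τ ∈ flagsIn (m + 1) (K + 1), cupCobdry s (m + 1) τ * χ (τ (m + 1)) =
      ∑ σ ∈ flagsIn (m + 1) (K + 1),
        cupCobdry s m σ * (s m (σ m) * (χ (σ m) + χ (σ (m + 1)))) := by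
    rw [← sub_eq_zero, ← Finset.sum_sub_distrib, ← h0]
    refine Finset.sum_congr rfl fun σ _ => ?_
    rw [cupCobdry_succ]
    linear_combination -cupCobdry s m σ * s m (σ m) * χ (σ m) * two
  have h2 : ∑ σ ∈ (flagsIn (m + 1) (K + 1)).filter (fun σ => ¬ 0 < σ (m + 1) m),
        cupCobdry s m σ * (s m (σ m) * (χ (σ m) + χ (σ (m + 1)))) =
      ∑ σ ∈ halfFlagsIn m (K + 1),
        cupCobdry s m (-σ) * (s m (-σ m) * (χ (σ m) + χ (σ (m + 1)))) := by
    symm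
    refine Finset.sum_bij' (fun σ _ => -σ) (fun σ _ => -σ) ?_ ?_ (fun _ _ => neg_neg _)
      (fun _ _ => neg_neg _) ?_
    · intro σ hσ
      rw [mem_halfFlagsIn] at hσ
      rw [Finset.mem_filter, mem_flagsIn]
      refine ⟨⟨hσ.1.1.neg, fun j i => by simpa using hσ.1.2 j i⟩, ?_⟩
      simpa using hσ.2.le
    · intro σ hσ
      rw [Finset.mem_filter, mem_flagsIn] at hσ
      rw [mem_halfFlagsIn]
      refine ⟨⟨hσ.1.1.neg, fun j i => by simpa using hσ.1.2 j i⟩, ?_⟩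
      obtain ⟨b, hb⟩ := hσ.1.1.odd_top m (by omega)
      have := hσ.2
      simp only [Pi.neg_apply]
      omega
    · intro σ _
      simp only [Pi.neg_apply, hχneg]
  rw [h1, ← Finset.sum_filter_add_sum_filter_not _ (fun σ : ℕ → ℕ → ℤ => 0 < σ (m + 1) m), h2,
    ← halfFlagsIn, ← Finset.sum_add_distrib]
  refine Finset.sum_congr rfl fun σ hσ => ?_
  have hfl := (mem_halfFlagsIn.1 hσ).1.1
  by_cases hz : σ 0 = 0
  · have h3 : ∀ j ≤ m + 1, χ (σ j) = 1 := fun j hj => hχ1 _ fun i => by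
      simpa [hz] using hfl.abs_sub_le (j := 0) (by omega) hj i
    rw [h3 m (by omega), h3 (m + 1) le_rfl]
    linear_combination (cupCobdry s m σ * s m (σ m) + cupCobdry s m (-σ) * s m (-σ m) -
      cupCobdry s m σ) * two
  · have h3 : ∀ j ≤ m, σ j ≠ 0 := by
      intro j hj
      rcases j with _ | j
      · exact hz
      · exact hfl.ne_zero_of_pos (by omega)
    rw [cupCobdry_neg hs h3, hs m _ (h3 m le_rfl)]
    linear_combination (cupCobdry s m σ * s m (σ m) * (χ (σ m) + χ (σ (m + 1)))) * two

lemma sum_flagsIn_cupCobdry_eq_one (hK : 0 ≤ K)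
    (hs : ∀ i v, v ≠ 0 → s i (-v) = s i v + 1) (hχneg : ∀ v, χ (-v) = χ v)
    (hχ1 : ∀ v : ℕ → ℤ, (∀ i, |v i| ≤ 1) → χ v = 1)
    (hχ : ∀ v, χ v ≠ 0 → ∀ i < n, |v i| ≤ K) {m : ℕ} (hm : m ≤ n) :
    ∑ τ ∈ flagsIn m (K + 1), cupCobdry s m τ * χ (τ m) = 1 := by
  induction m with
  | zero =>
    have h0 : flagsIn 0 (K + 1) = {0} := by
      ext σ
      rw [mem_flagsIn, Finset.mem_singleton]
      constructor
      · rintro ⟨h, -⟩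
        funext j
        rcases j with _ | j
        · funext i; exact h.zero_coord 0 le_rfl i (by omega)
        · exact h.zero_above _ (by omega)
      · rintro rfl
        exact ⟨⟨fun i => by simp, fun i hi => by omega, fun j _ i _ => rfl, fun j _ => rfl,
          fun j hj => by omega⟩, fun j i => by simp; omega⟩
    rw [h0, Finset.sum_singleton, hχ1 _ (by simp)]
    simp [cupCobdry]
  | succ m ih =>
    rw [sum_flagsIn_cupCobdry_succ hs hχneg hχ1 hχ (by omega),
      sum_halfFlagsIn_cupCobdry hK hχ (by omega), ih (by omega)]

/-- A Tucker-type lemma: given `n` labellings of the integer points by `ZMod 2` which are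
antisymmetric away from the origin, and a bounded symmetric region of `ℝ^(n+1)` containing the
neighbours of the origin, some cell meets the region and its complement and carries both values of
every labelling. -/
lemma exists_flag_forall_ne (n : ℕ)
    (hs : ∀ i v, v ≠ 0 → s i (-v) = s i v + 1) (hχneg : ∀ v, χ (-v) = χ v)
    (hχ1 : ∀ v : ℕ → ℤ, (∀ i, |v i| ≤ 1) → χ v = 1)
    (hχ : ∀ v, χ v ≠ 0 → ∀ i ≤ n, |v i| ≤ K) :
    ∃ σ : ℕ → ℕ → ℤ, IsFlag (n + 1) σ ∧ (∀ i < n, s i (σ i) ≠ s i (σ (i + 1))) ∧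
      χ (σ n) ≠ χ (σ (n + 1)) := by
  have hK : 0 ≤ K := (abs_nonneg _).trans
    (hχ 0 (by rw [hχ1 0 (by simp)]; exact one_ne_zero) 0 (by omega))
  have hχ' : ∀ v, χ v ≠ 0 → ∀ i < n + 1, |v i| ≤ K := fun v hv i hi => hχ v hv i (by omega)
  have h := sum_halfFlagsIn_cupCobdry (s := s) hK hχ' (Nat.lt_succ_self n)
  rw [sum_flagsIn_cupCobdry_eq_one hK hs hχneg hχ1 hχ' (by omega)] at h
  obtain ⟨σ, hσ, hne⟩ := Finset.exists_ne_zero_of_sum_ne_zero (h ▸ one_ne_zero)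
  refine ⟨σ, (mem_halfFlagsIn.1 hσ).1.1, fun i hi he => ?_, fun he => ?_⟩
  · refine Finset.prod_ne_zero_iff.1 (left_ne_zero_of_mul hne) i (Finset.mem_range.2 hi) ?_
    rw [he, CharTwo.add_self_eq_zero]
  · exact right_ne_zero_of_mul hne (by rw [he, CharTwo.add_self_eq_zero])

end labelling

/-- A symmetric way of attaching signs to the values of an odd function, ties being broken by a
well-order. -/
noncomputable def signLabel (f : (ℕ → ℤ) → ℝ) (v : ℕ → ℤ) : ZMod 2 :=
  open Classical in if 0 < f v ∨ (f v = 0 ∧ WellOrderingRel v (-v)) then 1 else 0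

lemma signLabel_neg {f : (ℕ → ℤ) → ℝ} (hf : ∀ v, f (-v) = -f v) {v : ℕ → ℤ} (hv : v ≠ 0) :
    signLabel f (-v) = signLabel f v + 1 := by
  have hne : v ≠ -v := fun h => hv (by
    funext i
    have := congrFun h i
    simp only [Pi.neg_apply, Pi.zero_apply] at this ⊢
    omega)
  have h11 : (0 : ZMod 2) = 1 + 1 := by decide
  unfold signLabel
  rw [hf, neg_neg]
  rcases lt_trichotomy (f v) 0 with h | h | h
  · rw [if_pos (Or.inl (by linarith)), if_neg, zero_add]
    rintro (h1 | h1) <;> linarith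
  · rcases trichotomous_of WellOrderingRel v (-v) with h1 | h1 | h1
    · rw [if_neg, if_pos (Or.inr ⟨h, h1⟩), h11]
      rintro (h2 | ⟨-, h2⟩)
      · linarith
      · exact asymm h1 h2
    · exact absurd h1 hne
    · rw [if_pos (Or.inr ⟨by linarith, h1⟩), if_neg, zero_add]
      rintro (h2 | ⟨-, h2⟩)
      · linarith
      · exact asymm h1 h2
  · rw [if_neg, if_pos (Or.inl h), h11]
    rintro (h1 | h1) <;> linarith

lemma exists_nonpos_nonneg_of_signLabel_ne {f : (ℕ → ℤ) → ℝ} {v w : ℕ → ℤ}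
    (h : signLabel f v ≠ signLabel f w) :
    (f v ≤ 0 ∧ 0 ≤ f w) ∨ (f w ≤ 0 ∧ 0 ≤ f v) := by
  unfold signLabel at h
  split_ifs at h with h1 h2 h2
  · exact absurd rfl h
  · refine Or.inr ⟨not_lt.1 fun h3 => h2 (Or.inl h3), ?_⟩
    rcases h1 with h1 | h1 <;> linarith
  · refine Or.inl ⟨not_lt.1 fun h3 => h1 (Or.inl h3), ?_⟩
    rcases h2 with h2 | h2 <;> linarith
  · exact absurd rfl h

lemma eventually_forall_norm_sub_le {E : Type*} [NormedAddCommGroup E] {Q : E → Prop} {x : E}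
    (hQ : ∀ᶠ y in 𝓝 x, Q y) :
    ∀ᶠ z : ℝ × E in 𝓝 (0, x), ∀ y, ‖y - z.2‖ ≤ z.1 → Q y := by
  obtain ⟨ε, hε, hQ⟩ := Metric.eventually_nhds_iff.1 hQ
  have h1 : ∀ᶠ z : ℝ × E in 𝓝 (0, x), z.1 < ε / 2 :=
    (continuous_fst.tendsto _).eventually_lt_const (by simpa using hε)
  have h2 : ∀ᶠ z : ℝ × E in 𝓝 (0, x), dist z.2 x < ε / 2 :=
    (continuous_snd.tendsto (0, x)).eventually (Metric.ball_mem_nhds x (half_pos hε))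
  filter_upwards [h1, h2] with z h1 h2 y hy
  refine hQ ?_
  rw [← dist_eq_norm] at hy
  linarith [dist_triangle y z.2 x]

lemma exists_forall_exists_nonpos_nonneg {n : ℕ} {Φ : (Fin (n + 1) → ℝ) → Fin n → ℝ}
    {h : (Fin (n + 1) → ℝ) → ℝ} (hodd : ∀ x, Φ (-x) = -Φ x) (heven : ∀ x, h (-x) = h x)
    {R : ℝ} (hR : ∀ x, h x < 0 → ‖x‖ ≤ R) {δ : ℝ} (hδ : 0 < δ)
    (hδ0 : ∀ x, ‖x‖ ≤ δ → h x < 0) :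
    ∃ x, (∀ i, (∃ y, ‖y - x‖ ≤ δ ∧ Φ y i ≤ 0) ∧ ∃ y, ‖y - x‖ ≤ δ ∧ 0 ≤ Φ y i) ∧
      (∃ y, ‖y - x‖ ≤ δ ∧ h y < 0) ∧ ∃ y, ‖y - x‖ ≤ δ ∧ 0 ≤ h y := by
  classical
  set p : (ℕ → ℤ) → Fin (n + 1) → ℝ := fun v i => δ * v i with hp
  have hpneg : ∀ v, p (-v) = -p v := fun v => by funext i; simp [hp]
  set s : ℕ → (ℕ → ℤ) → ZMod 2 := fun i =>
    if hi : i < n then signLabel fun v => Φ (p v) ⟨i, hi⟩ else signLabel fun v => v 0 with hs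
  set χ : (ℕ → ℤ) → ZMod 2 := fun v => if h (p v) < 0 then 1 else 0 with hχ
  have hsneg : ∀ i v, v ≠ 0 → s i (-v) = s i v + 1 := by
    intro i v hv
    simp only [hs]
    split_ifs with hi
    · exact signLabel_neg (fun w => by rw [hpneg, hodd, Pi.neg_apply]) hv
    · exact signLabel_neg (fun w => by simp) hv
  have hχ1 : ∀ v : ℕ → ℤ, (∀ i, |v i| ≤ 1) → χ v = 1 := by
    intro v hv
    refine if_pos (hδ0 _ ((pi_norm_le_iff_of_nonneg hδ.le).2 fun i => ?_))
    have h1 : |(v i : ℝ)| ≤ 1 := by exact_mod_cast hv i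
    rw [Real.norm_eq_abs, abs_mul, abs_of_pos hδ]
    nlinarith
  have hχK : ∀ v, χ v ≠ 0 → ∀ i ≤ n, |v i| ≤ ⌊R / δ⌋ := by
    intro v hv i hi
    have h1 : h (p v) < 0 := by
      by_contra h1
      exact hv (if_neg h1)
    have h2 := (norm_le_pi_norm (p v) ⟨i, by omega⟩).trans (hR _ h1)
    rw [Real.norm_eq_abs, abs_mul, abs_of_pos hδ] at h2
    rw [Int.le_floor, le_div_iff₀ hδ, Int.cast_abs, mul_comm]
    exact h2
  obtain ⟨σ, hσ, hσs, hσχ⟩ := exists_flag_forall_ne n hsneg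
    (fun v => by simp only [hχ, hpneg, heven]) hχ1 hχK
  have hdist : ∀ j ≤ n + 1, ‖p (σ j) - p (σ 0)‖ ≤ δ := by
    intro j hj
    refine (pi_norm_le_iff_of_nonneg hδ.le).2 fun i => ?_
    have h1 : |(σ j i - σ 0 i : ℝ)| ≤ 1 := by
      exact_mod_cast hσ.abs_sub_le (Nat.zero_le _) hj i
    have h2 : (p (σ j) - p (σ 0)) i = δ * (σ j i - σ 0 i) := by
      simp only [hp, Pi.sub_apply]; ring
    rw [h2, Real.norm_eq_abs, abs_mul, abs_of_pos hδ]
    nlinarith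
  refine ⟨p (σ 0), fun i => ?_, ?_⟩
  · have h1 := hσs i i.2
    simp only [hs, i.2, dif_pos] at h1
    rcases exists_nonpos_nonneg_of_signLabel_ne h1 with h2 | h2
    · exact ⟨⟨_, hdist i (by omega), h2.1⟩, _, hdist (i + 1) (by omega), h2.2⟩
    · exact ⟨⟨_, hdist (i + 1) (by omega), h2.1⟩, _, hdist i (by omega), h2.2⟩
  · simp only [hχ] at hσχ
    split_ifs at hσχ with h1 h2 h2
    · exact absurd rfl hσχ
    · exact ⟨⟨_, hdist n (by omega), h1⟩, _, hdist (n + 1) le_rfl, not_lt.1 h2⟩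
    · exact ⟨⟨_, hdist (n + 1) le_rfl, h2⟩, _, hdist n (by omega), not_lt.1 h1⟩
    · exact absurd rfl hσχ

/-- A form of the Borsuk–Ulam theorem: an odd map `ℝ^(n+1) → ℝ^n` vanishes somewhere on the
boundary of any bounded symmetric neighbourhood of the origin. -/
lemma exists_eq_zero_of_odd {n : ℕ} {Φ : (Fin (n + 1) → ℝ) → Fin n → ℝ}
    {h : (Fin (n + 1) → ℝ) → ℝ} (hΦ : Continuous Φ) (hh : Continuous h)
    (hodd : ∀ x, Φ (-x) = -Φ x) (heven : ∀ x, h (-x) = h x) (h0 : h 0 < 0)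
    {R : ℝ} (hR : ∀ x, h x < 0 → ‖x‖ ≤ R) :
    ∃ x, Φ x = 0 ∧ h x = 0 := by
  by_contra! hne
  have key : ∀ᶠ δ : ℝ in 𝓝 0, ∀ x ∈ Metric.closedBall (0 : Fin (n + 1) → ℝ) (R + 1),
      ¬ ((∀ i, (∃ y, ‖y - x‖ ≤ δ ∧ Φ y i ≤ 0) ∧ ∃ y, ‖y - x‖ ≤ δ ∧ 0 ≤ Φ y i) ∧
      (∃ y, ‖y - x‖ ≤ δ ∧ h y < 0) ∧ ∃ y, ‖y - x‖ ≤ δ ∧ 0 ≤ h y) := by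
    refine (isCompact_closedBall _ _).eventually_forall_of_forall_eventually fun x _ => ?_
    by_cases hx : Φ x = 0
    · rcases lt_or_gt_of_ne (hne x hx) with h1 | h1
      · filter_upwards [eventually_forall_norm_sub_le
          ((hh.tendsto x).eventually_lt_const h1)] with z hz
        rintro ⟨-, -, y, hy, hy'⟩
        exact (hz y hy).not_ge hy'
      · filter_upwards [eventually_forall_norm_sub_le
          ((hh.tendsto x).eventually_const_lt h1)] with z hz
        rintro ⟨-, ⟨y, hy, hy'⟩, -⟩
        exact (hz y hy).not_gt hy'
    · obtain ⟨i, hi⟩ := Function.ne_iff.1 hx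
      have hc : Continuous fun x => Φ x i := (continuous_apply i).comp hΦ
      rcases lt_or_gt_of_ne hi with h1 | h1
      · filter_upwards [eventually_forall_norm_sub_le
          ((hc.tendsto x).eventually_lt_const h1)] with z hz
        rintro ⟨hz', -⟩
        obtain ⟨y, hy, hy'⟩ := (hz' i).2
        exact (hz y hy).not_ge hy'
      · filter_upwards [eventually_forall_norm_sub_le
          ((hc.tendsto x).eventually_const_lt h1)] with z hz
        rintro ⟨hz', -⟩
        obtain ⟨y, hy, hy'⟩ := (hz' i).1
        exact (hz y hy).not_ge hy'
  have h1 := eventually_forall_norm_sub_le ((hh.tendsto 0).eventually_lt_const h0)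
  rw [nhds_prod_eq] at h1
  have h2 : ∀ᶠ δ : ℝ in 𝓝 0, ∀ x : Fin (n + 1) → ℝ, ‖x‖ ≤ δ → h x < 0 := by
    filter_upwards [h1.curry] with δ hδ x hx
    exact hδ.self_of_nhds x (by simpa using hx)
  obtain ⟨δ, hδ, hδ1, hδ2, hδ3⟩ :=
    ((eventually_mem_nhdsWithin (a := (0 : ℝ)) (s := Set.Ioi 0)).and
      (((gt_mem_nhds (zero_lt_one' ℝ)).and (key.and h2)).filter_mono nhdsWithin_le_nhds)).exists
  obtain ⟨x, hx⟩ := exists_forall_exists_nonpos_nonneg hodd heven hR hδ hδ3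
  refine hδ2 x ?_ hx
  obtain ⟨y, hy, hy'⟩ := hx.2.1
  rw [mem_closedBall_zero_iff]
  have := hR y hy'
  have h3 := norm_sub_norm_le x y
  rw [norm_sub_rev] at h3
  linarith

/-- Ekeland's variational principle. -/
lemma exists_forall_lt_add_mul_dist {α : Type*} [MetricSpace α] [CompleteSpace α] {f : α → ℝ}
    (hf : LowerSemicontinuous f) (hbdd : BddBelow (Set.range f)) {ε : ℝ} (hε : 0 < ε) (x₀ : α) :
    ∃ x, f x + ε * dist x₀ x ≤ f x₀ ∧ ∀ y, y ≠ x → f x < f y + ε * dist x y := by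
  set S : α → Set α := fun x => {y | f y + ε * dist x y ≤ f x} with hS
  have hself : ∀ x, x ∈ S x := fun x => by simp [hS]
  have htrans : ∀ {x y z}, y ∈ S x → z ∈ S y → z ∈ S x := by
    intro x y z hy hz
    simp only [hS, Set.mem_ofPred_eq] at *
    nlinarith [dist_triangle x y z]
  have hle : ∀ {x y}, y ∈ S x → f y ≤ f x := by
    intro x y hy
    have : 0 ≤ ε * dist x y := by positivity
    simp only [hS, Set.mem_ofPred_eq] at hy
    linarith
  have hclosed : ∀ x, IsClosed (S x) := by
    intro x
    have h1 : LowerSemicontinuous fun y => f y + ε * dist x y :=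
      hf.add (by fun_prop : Continuous fun y => ε * dist x y).lowerSemicontinuous
    exact h1.isClosed_preimage (f x)
  have hnext : ∀ (n : ℕ) (x : α), ∃ y ∈ S x, ∀ z ∈ S x, f y ≤ f z + 1 / ((n : ℝ) + 1) := by
    intro n x
    have hne : (f '' S x).Nonempty := ⟨_, x, hself x, rfl⟩
    have hb : BddBelow (f '' S x) := hbdd.mono (Set.image_subset_range _ _)
    obtain ⟨-, ⟨y, hy, rfl⟩, hlt⟩ := exists_lt_of_csInf_lt hne
      (lt_add_of_pos_right (sInf (f '' S x)) (Nat.one_div_pos_of_nat (n := n) (α := ℝ)))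
    refine ⟨y, hy, fun z hz => ?_⟩
    have := csInf_le hb ⟨z, hz, rfl⟩
    linarith
  choose next hnextS hnextle using hnext
  set x : ℕ → α := fun n => Nat.rec x₀ next n with hx
  have hxs : ∀ n, x (n + 1) = next n (x n) := fun n => rfl
  have hmem : ∀ {n m}, n ≤ m → x m ∈ S (x n) := by
    intro n m hnm
    induction m, hnm using Nat.le_induction with
    | base => exact hself _
    | succ m _ ih => exact htrans ih (hxs m ▸ hnextS m (x m))
  have hanti : Antitone fun n => f (x n) := fun n m hnm => hle (hmem hnm)
  have hlim := tendsto_atTop_ciInf hanti (hbdd.mono (by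
    rintro _ ⟨n, rfl⟩
    exact ⟨x n, rfl⟩))
  have hcauchy : CauchySeq x := by
    rw [Metric.cauchySeq_iff']
    intro η hη
    obtain ⟨N, hN⟩ := Metric.cauchySeq_iff'.1 hlim.cauchySeq (ε * η) (by positivity)
    refine ⟨N, fun n hn => ?_⟩
    have h1 := (abs_lt.1 (hN n hn)).1
    have h2 := hmem hn
    simp only [hS, Set.mem_ofPred_eq] at h2
    rw [dist_comm]
    have : ε * dist (x N) (x n) < ε * η := by linarith
    exact lt_of_mul_lt_mul_left this hε.le
  obtain ⟨a, ha⟩ := cauchySeq_tendsto_of_complete hcauchy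
  have haS : ∀ n, a ∈ S (x n) := fun n => (hclosed _).mem_of_tendsto ha
    (eventually_atTop.2 ⟨n, fun m hm => hmem hm⟩)
  refine ⟨a, haS 0, fun y hy => ?_⟩
  by_contra! hya
  have h1 : f a ≤ f y := by
    refine ge_of_tendsto' (x := atTop) (f := fun n : ℕ => f y + 1 / ((n : ℝ) + 1)) ?_ fun n => ?_
    · simpa using tendsto_one_div_add_atTop_nhds_zero_nat.const_add (f y)
    · exact (hle (haS (n + 1))).trans (hnextle n (x n) y (htrans (haS n) hya))
  have h2 : 0 < ε * dist a y := mul_pos hε (dist_pos.2 hy.symm)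
  linarith

section descent

variable {X : Type*} [NormedAddCommGroup X] [NormedSpace ℝ X] {I : X → ℝ}

lemma exists_norm_le_one_lt_apply {L : X →L[ℝ] ℝ} {ε : ℝ} (h : ε < ‖L‖) :
    ∃ v, ‖v‖ ≤ 1 ∧ ε < L v := by
  obtain ⟨v, hv, hLv⟩ := L.exists_lt_apply_of_lt_opNorm h
  rcases le_total 0 (L v) with h0 | h0
  · exact ⟨v, hv.le, by rwa [Real.norm_of_nonneg h0] at hLv⟩
  · exact ⟨-v, by rw [norm_neg]; exact hv.le, by rwa [map_neg, ← Real.norm_of_nonpos h0]⟩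

lemma fderiv_neg_of_even (heven : ∀ u, I (-u) = I u) (u : X) :
    fderiv ℝ I (-u) = -fderiv ℝ I u := by
  have h := (LinearIsometryEquiv.neg ℝ (E := X)).toContinuousLinearEquiv.comp_right_fderiv
    (f := I) (x := u)
  have h1 : I ∘ (LinearIsometryEquiv.neg ℝ (E := X)).toContinuousLinearEquiv = I := by
    funext v; simp [heven]
  rw [h1] at h
  ext v
  simp [h]

/-- An odd continuous pseudo-gradient field along an odd map. -/
lemma exists_odd_pseudoGradient {E : Type*} [NormedAddCommGroup E]
    (hI : ContDiff ℝ 1 I) (heven : ∀ u, I (-u) = I u) {γ : E → X} (hγ : Continuous γ)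
    (hodd : ∀ x, γ (-x) = -γ x) {B C : Set E} (hB : IsClosed B) (hC : IsClosed C)
    (hBC : Disjoint B C) (hBneg : ∀ x ∈ B, -x ∈ B) (hCneg : ∀ x ∈ C, -x ∈ C) {ε : ℝ}
    (hε : ∀ x ∈ C, ε < ‖fderiv ℝ I (γ x)‖) :
    ∃ V : C(E, X), (∀ x, V (-x) = -V x) ∧ (∀ x, ‖V x‖ ≤ 1) ∧ (∀ x ∈ B, V x = 0) ∧
      ∀ x ∈ C, ε < fderiv ℝ I (γ x) (V x) := by
  have hdc : Continuous fun x => fderiv ℝ I (γ x) := (hI.continuous_fderiv one_ne_zero).comp hγ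
  set t : E → Set X := fun x => {v | ‖v‖ ≤ 1 ∧ (x ∈ B → v = 0) ∧
    (x ∈ C → ε < fderiv ℝ I (γ x) v)} with ht
  have hconv : ∀ x, Convex ℝ (t x) := by
    rintro x v ⟨hv1, hv2, hv3⟩ w ⟨hw1, hw2, hw3⟩ a b ha hb hab
    refine ⟨?_, fun hx => by simp [hv2 hx, hw2 hx], fun hx => ?_⟩
    · have := convex_closedBall (0 : X) 1 (mem_closedBall_zero_iff.2 hv1)
        (mem_closedBall_zero_iff.2 hw1) ha hb hab
      exact mem_closedBall_zero_iff.1 this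
    · exact (convex_halfSpace_gt (fderiv ℝ I (γ x)).isLinear ε) (hv3 hx) (hw3 hx) ha hb hab
  obtain ⟨g, hg⟩ := exists_continuous_forall_mem_convex_of_local_const hconv (by
    intro x
    by_cases hx : x ∈ C
    · obtain ⟨v, hv, hv'⟩ := exists_norm_le_one_lt_apply (hε x hx)
      have hxB : x ∉ B := fun h => Set.disjoint_left.1 hBC h hx
      refine ⟨v, ?_⟩
      filter_upwards [hB.isOpen_compl.mem_nhds hxB,
        ((hdc.clm_apply continuous_const).tendsto x).eventually_const_lt hv'] with y hy hy'
      exact ⟨hv, fun h => absurd h hy, fun _ => hy'⟩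
    · refine ⟨0, ?_⟩
      filter_upwards [hC.isOpen_compl.mem_nhds hx] with y hy
      exact ⟨by simp, fun _ => rfl, fun h => absurd h hy⟩)
  refine ⟨⟨fun x => (1 / 2 : ℝ) • (g x - g (-x)), by fun_prop⟩, fun x => ?_, fun x => ?_,
    fun x hx => ?_, fun x hx => ?_⟩
  · simp [← smul_neg]
  · simp only [ContinuousMap.coe_mk, norm_smul]
    have := norm_sub_le (g x) (g (-x))
    have h1 := (hg x).1
    have h2 := (hg (-x)).1
    norm_num
    linarith
  · simp [(hg x).2.1 hx, (hg (-x)).2.1 (hBneg x hx)]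
  · have h1 := (hg x).2.2 hx
    have h2 := (hg (-x)).2.2 (hCneg x hx)
    rw [hodd, fderiv_neg_of_even heven, neg_apply] at h2
    simp only [ContinuousMap.coe_mk, map_smul, map_sub, smul_eq_mul]
    linarith

lemma eventually_forall_lt_sub_mul {E : Type*} [TopologicalSpace E] (hI : ContDiff ℝ 1 I)
    {γ V : E → X} (hγ : Continuous γ) (hV : Continuous V) (hV1 : ∀ x, ‖V x‖ ≤ 1)
    {D : Set E} (hD : IsCompact D) {m ε : ℝ} (hε : 0 < ε) (hm : ∀ x ∈ D, I (γ x) ≤ m)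
    (hVε : ∀ x ∈ D, m - ε ≤ I (γ x) → 2 * ε < fderiv ℝ I (γ x) (V x)) :
    ∀ᶠ τ : ℝ in 𝓝 0, ∀ x ∈ D, 0 < τ → I (γ x - τ • V x) < m - ε * τ := by
  suffices h : ∀ᶠ τ : ℝ in 𝓝 0, ∀ x ∈ D, x ∈ D → 0 < τ → I (γ x - τ • V x) < m - ε * τ from
    h.mono fun τ hτ x hx => hτ x hx hx
  refine hD.eventually_forall_of_forall_eventually fun x hx => ?_
  have hc : Continuous fun z : ℝ × E => γ z.2 - z.1 • V z.2 := by fun_prop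
  have hc0 : Tendsto (fun z : ℝ × E => γ z.2 - z.1 • V z.2) (𝓝 (0, x)) (𝓝 (γ x)) := by
    simpa using hc.tendsto (0, x)
  by_cases hxm : m - ε ≤ I (γ x)
  · have hs : HasStrictFDerivAt I (fderiv ℝ I (γ x)) (γ x) :=
      hI.contDiffAt.hasStrictFDerivAt one_ne_zero
    have h1 := hs.isLittleO.def (half_pos hε)
    have h2 : Tendsto (fun z : ℝ × E => (γ z.2 - z.1 • V z.2, γ z.2)) (𝓝 (0, x))
        (𝓝 (γ x, γ x)) :=
      hc0.prodMk_nhds ((hγ.comp continuous_snd).tendsto (0, x))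
    have h3 : ∀ᶠ z : ℝ × E in 𝓝 (0, x), 2 * ε < fderiv ℝ I (γ x) (V z.2) := by
      have : Continuous fun z : ℝ × E => fderiv ℝ I (γ x) (V z.2) := by fun_prop
      exact (this.tendsto (0, x)).eventually_const_lt (hVε x hx hxm)
    filter_upwards [h2.eventually h1, h3] with z h1 h3 hz hτ
    have h4 : γ z.2 - z.1 • V z.2 - γ z.2 = -(z.1 • V z.2) := by abel
    simp only [h4, map_neg, map_smul, norm_neg, norm_smul, smul_eq_mul, Real.norm_eq_abs,
      abs_of_pos hτ] at h1
    have h5 := (abs_le.1 h1).2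
    have h6 := mul_le_mul_of_nonneg_left (hV1 z.2) hτ.le
    have h7 := mul_lt_mul_of_pos_left h3 hτ
    have h8 := hm z.2 hz
    nlinarith
  · have h1 : ∀ᶠ z : ℝ × E in 𝓝 (0, x), I (γ z.2 - z.1 • V z.2) < m - ε :=
      ((hI.continuous.tendsto _).comp hc0).eventually_lt_const (not_le.1 hxm)
    have h2 : ∀ᶠ z : ℝ × E in 𝓝 (0, x), z.1 < 1 :=
      (continuous_fst.tendsto (0, x)).eventually_lt_const zero_lt_one
    filter_upwards [h1, h2] with z h1 h2 _ _
    nlinarith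

end descent

section minimax

variable {X : Type*} [NormedAddCommGroup X] [NormedSpace ℝ X] {I : X → ℝ}

/-- The minimax principle for odd deformations: a linking condition yields a Palais–Smale
sequence. -/
lemma exists_palaisSmale_sequence [CompleteSpace X] {E : Type*} [NormedAddCommGroup E]
    (hI : ContDiff ℝ 1 I) (heven : ∀ u, I (-u) = I u) {γ₀ : E → X} (hγ₀ : Continuous γ₀)
    (hγ₀odd : ∀ x, γ₀ (-x) = -γ₀ x) {D B : Set E} (hD : IsCompact D) (hB : IsClosed B)
    (hDneg : ∀ x ∈ D, -x ∈ D) (hBneg : ∀ x ∈ B, -x ∈ B)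
    (hDB : ∀ x ∈ D, x ∈ B → I (γ₀ x) ≤ 0) {c₀ : ℝ} (hc₀ : 0 < c₀)
    (hlink : ∀ φ : BoundedContinuousFunction E X, (∀ x, φ (-x) = -φ x) → (∀ x ∈ B, φ x = 0) →
      ∃ x ∈ D, c₀ ≤ I (γ₀ x + φ x)) :
    ∃ c, c₀ ≤ c ∧ ∃ u : ℕ → X, Tendsto (fun n => I (u n)) atTop (𝓝 c) ∧
      Tendsto (fun n => ‖fderiv ℝ I (u n)‖) atTop (𝓝 0) := by
  set Γ : Set (BoundedContinuousFunction E X) :=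
    {φ | (∀ x, φ (-x) = -φ x) ∧ ∀ x ∈ B, φ x = 0} with hΓ
  have hev : ∀ x : E, Continuous fun φ : BoundedContinuousFunction E X => φ x := fun x =>
    (BoundedContinuousFunction.lipschitz_eval_const x).continuous
  have hΓclosed : IsClosed Γ := by
    have h1 : Γ = (⋂ x, {φ | φ (-x) = -φ x}) ∩ ⋂ x ∈ B, {φ | φ x = 0} := by
      ext φ; simp [hΓ]
    rw [h1]
    refine (isClosed_iInter fun x => isClosed_eq (hev _) (hev x).neg).inter
      (isClosed_biInter fun x _ => isClosed_eq (hev x) continuous_const)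
  have : CompleteSpace Γ := hΓclosed.completeSpace_coe
  have h0Γ : (0 : BoundedContinuousFunction E X) ∈ Γ := by simp [hΓ]
  have : Nonempty Γ := ⟨⟨0, h0Γ⟩⟩
  have hDne : D.Nonempty := by
    obtain ⟨x, hx, -⟩ := hlink 0 h0Γ.1 h0Γ.2
    exact ⟨x, hx⟩
  set Ψ : Γ → ℝ := fun φ => sSup ((fun x => I (γ₀ x + φ.1 x)) '' D) with hΨ
  have hcont : ∀ φ : Γ, Continuous fun x => I (γ₀ x + φ.1 x) := fun φ =>
    hI.continuous.comp (hγ₀.add φ.1.continuous)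
  have hmax : ∀ φ : Γ, ∃ x ∈ D, Ψ φ = I (γ₀ x + φ.1 x) ∧ ∀ y ∈ D, I (γ₀ y + φ.1 y) ≤ Ψ φ := by
    intro φ
    obtain ⟨x, hx, h1, h2⟩ := hD.exists_sSup_image_eq_and_ge hDne (hcont φ).continuousOn
    exact ⟨x, hx, h1, fun y hy => (h2 y hy).trans h1.ge⟩
  have hΨge : ∀ φ : Γ, c₀ ≤ Ψ φ := by
    intro φ
    obtain ⟨x, hx, h1⟩ := hlink φ.1 φ.2.1 φ.2.2
    obtain ⟨-, -, -, h2⟩ := hmax φ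
    exact h1.trans (h2 x hx)
  have hΨbdd : BddBelow (Set.range Ψ) := ⟨c₀, by rintro _ ⟨φ, rfl⟩; exact hΨge φ⟩
  have hΨlsc : LowerSemicontinuous Ψ := by
    intro φ a ha
    obtain ⟨x, hx, h1, -⟩ := hmax φ
    have h2 : Continuous fun ψ : Γ => I (γ₀ x + ψ.1 x) :=
      hI.continuous.comp (continuous_const.add ((hev x).comp continuous_subtype_val))
    filter_upwards [(h2.tendsto φ).eventually_const_lt (h1 ▸ ha)] with ψ hψ
    obtain ⟨-, -, -, h3⟩ := hmax ψ
    exact hψ.trans_le (h3 x hx)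
  set c := ⨅ φ, Ψ φ with hc
  have hcc₀ : c₀ ≤ c := le_ciInf hΨge
  have key : ∀ ε, 0 < ε → ∃ u, |I u - c| ≤ ε ∧ ‖fderiv ℝ I u‖ ≤ 2 * ε := by
    suffices h : ∀ ε, 0 < ε → ε < c₀ → ∃ u, |I u - c| ≤ ε ∧ ‖fderiv ℝ I u‖ ≤ 2 * ε by
      intro ε hε
      obtain ⟨u, h1, h2⟩ := h (min ε (c₀ / 2)) (lt_min hε (half_pos hc₀))
        ((min_le_right _ _).trans_lt (half_lt_self hc₀))
      have := min_le_left ε (c₀ / 2)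
      exact ⟨u, by linarith, by linarith⟩
    intro ε hε hεc
    obtain ⟨φ₁, hφ₁⟩ := exists_lt_of_ciInf_lt (lt_add_of_pos_right c hε)
    obtain ⟨φ, hφ, hφmin⟩ := exists_forall_lt_add_mul_dist hΨlsc hΨbdd hε φ₁
    set m := Ψ φ with hm
    have hm1 : c ≤ m := ciInf_le hΨbdd φ
    have hm2 : m < c + ε := by
      have : 0 ≤ ε * dist φ₁ φ := by positivity
      linarith
    set γ : E → X := fun x => γ₀ x + φ.1 x with hγ
    have hγc : Continuous γ := hγ₀.add φ.1.continuous
    have hγodd : ∀ x, γ (-x) = -γ x := fun x => by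
      simp only [hγ, hγ₀odd, φ.2.1]; abel
    have hγm : ∀ x ∈ D, I (γ x) ≤ m := by
      obtain ⟨-, -, -, h⟩ := hmax φ
      exact h
    by_contra! hcon
    set C : Set E := D ∩ {x | m - ε ≤ I (γ x)} with hC
    obtain ⟨V, hVodd, hV1, hVB, hVC⟩ := exists_odd_pseudoGradient (B := B) (C := C) (ε := 2 * ε)
      hI heven hγc hγodd hB
      (hD.isClosed.inter (isClosed_le continuous_const (hI.continuous.comp hγc))) (by
        rw [Set.disjoint_left]
        rintro x hxB ⟨hxD, hx⟩
        have h1 : γ x = γ₀ x := by simp [hγ, φ.2.2 x hxB]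
        rw [Set.mem_ofPred_eq, h1] at hx
        linarith [hDB x hxD hxB]) hBneg (by
        rintro x ⟨hxD, hx⟩
        refine ⟨hDneg x hxD, ?_⟩
        rwa [Set.mem_ofPred_eq, hγodd, heven]) (by
        rintro x ⟨hxD, hx⟩
        rw [Set.mem_ofPred_eq] at hx
        refine hcon (γ x) (abs_le.2 ⟨by linarith, ?_⟩)
        linarith [hγm x hxD])
    obtain ⟨τ, hτ, hτD⟩ := ((eventually_mem_nhdsWithin (a := (0 : ℝ)) (s := Set.Ioi 0)).and
      ((eventually_forall_lt_sub_mul hI hγc V.continuous hV1 hD hε hγm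
        fun x hx hxm => hVC x ⟨hx, hxm⟩).filter_mono nhdsWithin_le_nhds)).exists
    rw [Set.mem_Ioi] at hτ
    set W : BoundedContinuousFunction E X :=
      BoundedContinuousFunction.ofNormedAddCommGroup V V.continuous 1 hV1 with hW
    have hWV : ∀ x, W x = V x := fun x => rfl
    have hψ : φ.1 - τ • W ∈ Γ := by
      refine ⟨fun x => ?_, fun x hx => ?_⟩
      · simp only [BoundedContinuousFunction.sub_apply, BoundedContinuousFunction.smul_apply, hWV,
          hVodd, φ.2.1, smul_neg]
        abel
      · simp [hWV, hVB x hx, φ.2.2 x hx]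
    obtain ⟨x, hx, h1, -⟩ := hmax ⟨_, hψ⟩
    have h2 : Ψ ⟨_, hψ⟩ < m - ε * τ := by
      rw [h1]
      convert hτD x hx hτ using 2
      simp only [BoundedContinuousFunction.sub_apply, BoundedContinuousFunction.smul_apply, hWV, hγ]
      abel
    have h3 : dist φ ⟨_, hψ⟩ ≤ τ := by
      rw [Subtype.dist_eq, dist_eq_norm, sub_sub_cancel, norm_smul, Real.norm_of_nonneg hτ.le]
      have : ‖W‖ ≤ 1 := (BoundedContinuousFunction.norm_le zero_le_one).2 hV1
      nlinarith
    have h4 : m ≤ Ψ ⟨_, hψ⟩ + ε * dist φ ⟨_, hψ⟩ := by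
      by_cases h : (⟨_, hψ⟩ : Γ) = φ
      · rw [h, dist_self]; simp [hm]
      · exact (hφmin _ h).le
    nlinarith
  choose u hu hu' using fun n : ℕ => key (1 / ((n : ℝ) + 1)) Nat.one_div_pos_of_nat
  have hlim := tendsto_one_div_add_atTop_nhds_zero_nat (𝕜 := ℝ)
  refine ⟨c, hcc₀, u, ?_, ?_⟩
  · rw [tendsto_iff_dist_tendsto_zero]
    exact squeeze_zero (fun _ => dist_nonneg) hu hlim
  · exact squeeze_zero (fun _ => norm_nonneg _) hu' (by simpa using hlim.const_mul 2)

end minimax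

section biorthogonal

variable {X : Type*} [NormedAddCommGroup X] [NormedSpace ℝ X] {e : ℕ → X} {estar : ℕ → X →L[ℝ] ℝ}

lemma mem_closure_span_of_forall_apply_eq_zero
    (hdual : ∀ i j, estar i (e j) = if i = j then (1 : ℝ) else 0)
    (hdense : Dense (Submodule.span ℝ (Set.range e) : Set X)) {k : ℕ} {u : X}
    (hu : ∀ i < k, estar i u = 0) :
    u ∈ (Submodule.span ℝ (e '' {j | k ≤ j})).topologicalClosure := by
  set P : X →L[ℝ] X :=
    ContinuousLinearMap.id ℝ X - ∑ i ∈ Finset.range k, (estar i).smulRight (e i) with hP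
  have hPapply : ∀ x, P x = x - ∑ i ∈ Finset.range k, estar i x • e i := fun x => by
    simp [hP]
  have hmaps : Submodule.span ℝ (Set.range e) ≤
      (Submodule.span ℝ (e '' {j | k ≤ j})).comap P.toLinearMap := by
    rw [Submodule.span_le]
    rintro _ ⟨j, rfl⟩
    simp only [Submodule.comap_coe, Set.mem_preimage, ContinuousLinearMap.coe_coe, hPapply, hdual,
      ite_smul, one_smul, zero_smul, Finset.sum_ite_eq', Finset.mem_range, SetLike.mem_coe]
    split_ifs with hj
    · simp
    · rw [sub_zero]
      exact Submodule.subset_span ⟨j, not_lt.1 hj, rfl⟩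
  have hPu : P u = u := by
    rw [hPapply, Finset.sum_eq_zero, sub_zero]
    intro i hi
    rw [hu i (Finset.mem_range.1 hi), zero_smul]
  rw [← hPu]
  exact map_mem_closure P.continuous (hdense u) hmaps

/-- The intersection lemma: odd maps of finite-dimensional balls which are the identity far out
meet the small spheres of the complementary subspaces. -/
lemma exists_mem_sphere_of_odd
    (hdual : ∀ i j, estar i (e j) = if i = j then (1 : ℝ) else 0)
    (hdense : Dense (Submodule.span ℝ (Set.range e) : Set X)) {k : ℕ} {r ρ : ℝ} (hr : 0 < r)
    (hrρ : r < ρ) {γ : (Fin (k + 1) → ℝ) → X} (hγ : Continuous γ) (hodd : ∀ x, γ (-x) = -γ x)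
    (hγρ : ∀ x, ρ ≤ ‖∑ i : Fin (k + 1), x i • e i‖ →
      γ x = ∑ i : Fin (k + 1), x i • e i)
    {R : ℝ} (hR : ∀ x : Fin (k + 1) → ℝ, ‖∑ i : Fin (k + 1), x i • e i‖ ≤ ρ → ‖x‖ ≤ R) :
    ∃ x, ‖∑ i : Fin (k + 1), x i • e i‖ ≤ ρ ∧ ‖γ x‖ = r ∧
      γ x ∈ (Submodule.span ℝ (e '' {j | k ≤ j})).topologicalClosure := by
  have hle : ∀ x, ‖γ x‖ ≤ r → ‖∑ i : Fin (k + 1), x i • e i‖ ≤ ρ := by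
    intro x hx
    by_contra! h
    rw [hγρ x h.le] at hx
    linarith
  have hγ0 : γ 0 = 0 := by
    have h := hodd 0
    rw [neg_zero] at h
    have := IsAddTorsionFree.of_isTorsionFree ℝ X
    exact self_eq_neg.1 h
  obtain ⟨x, hx, hx'⟩ := exists_eq_zero_of_odd (n := k) (Φ := fun x i => estar i (γ x))
    (h := fun x => ‖γ x‖ - r) (by fun_prop) (by fun_prop)
    (fun x => by funext i; simp [hodd]) (fun x => by simp [hodd]) (by simp [hγ0, hr])
    (fun x hx => hR x (hle x (by linarith)))
  have hxr : ‖γ x‖ = r := by linarith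
  exact ⟨x, hle x hxr.le, hxr, mem_closure_span_of_forall_apply_eq_zero hdual hdense
    fun i hi => congrFun hx ⟨i, hi⟩⟩

end biorthogonal

theorem fountain_theorem
    {X : Type*} [NormedAddCommGroup X] [NormedSpace ℝ X] [CompleteSpace X]
    [TopologicalSpace.SeparableSpace X]
    (hrefl : Function.Surjective (NormedSpace.inclusionInDoubleDual ℝ X))
    (hinf : ¬ FiniteDimensional ℝ X)
    (e : ℕ → X) (estar : ℕ → X →L[ℝ] ℝ)
    (hdual : ∀ i j, estar i (e j) = if i = j then (1 : ℝ) else 0)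
    (hdense : Dense (Submodule.span ℝ (Set.range e) : Set X))
    (I : X → ℝ) (hI : ContDiff ℝ 1 I) (heven : ∀ u : X, I (-u) = I u)
    (r ρ : ℕ → ℝ) (hr : ∀ k, 0 < r k) (hrρ : ∀ k, r k < ρ k)
    -- (A1): inf of I on the sphere of radius r k in Z k tends to +∞
    (hA1 : Tendsto (fun k => sInf {c : ℝ | ∃ u : X,
        u ∈ (Submodule.span ℝ (e '' {j | k ≤ j})).topologicalClosure ∧ ‖u‖ = r k ∧ c = I u})
      atTop atTop)
    -- (A2): I ≤ 0 on the sphere of radius ρ k in Y k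
    (hA2 : ∀ k, ∀ u ∈ Submodule.span ℝ (e '' {j | j ≤ k}), ‖u‖ = ρ k → I u ≤ 0)
    -- (A3): I satisfies the (PS)_c condition for every c > 0
    (hA3 : ∀ c : ℝ, 0 < c → ∀ u : ℕ → X,
      Tendsto (fun n => I (u n)) atTop (𝓝 c) →
      Tendsto (fun n => ‖fderiv ℝ I (u n)‖) atTop (𝓝 0) →
      ∃ (v : X) (φ : ℕ → ℕ), StrictMono φ ∧ Tendsto (u ∘ φ) atTop (𝓝 v)) :
    ∃ u : ℕ → X, (∀ k, fderiv ℝ I (u k) = 0) ∧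
      Tendsto (fun k => I (u k)) atTop atTop := by
  suffices h : ∀ M : ℕ, ∃ u, fderiv ℝ I u = 0 ∧ (M : ℝ) ≤ I u by
    choose u hu hu' using h
    exact ⟨u, hu, tendsto_atTop_mono hu' tendsto_natCast_atTop_atTop⟩
  intro M
  obtain ⟨k, hk⟩ := (hA1.eventually_ge_atTop ((M : ℝ) + 1)).exists
  have hM : (0 : ℝ) < M + 1 := by positivity
  have hsphere : ∀ u ∈ (Submodule.span ℝ (e '' {j | k ≤ j})).topologicalClosure, ‖u‖ = r k →
      (M : ℝ) + 1 ≤ I u := by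
    intro u hu hur
    refine hk.trans (csInf_le ?_ ⟨u, hu, hur, rfl⟩)
    by_contra hb
    rw [Real.sInf_of_not_bddBelow hb] at hk
    linarith
  set J : (Fin (k + 1) → ℝ) → X := fun x => ∑ i : Fin (k + 1), x i • e i with hJ
  have hJc : Continuous J := by fun_prop
  have hJneg : ∀ x, J (-x) = -J x := fun x => by simp [hJ]
  have hcoord : ∀ x (i : Fin (k + 1)), estar i (J x) = x i := by
    intro x i
    simp [hJ, hdual, Fin.val_inj]
  have hR : ∀ x, ‖J x‖ ≤ ρ k → ‖x‖ ≤ ∑ i : Fin (k + 1), ‖estar i‖ * ρ k := by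
    intro x hx
    have hρ : 0 ≤ ρ k := (norm_nonneg _).trans hx
    have hnn : ∀ i : Fin (k + 1), 0 ≤ ‖estar i‖ * ρ k := fun i => by positivity
    refine (pi_norm_le_iff_of_nonneg (Finset.sum_nonneg fun i _ => hnn i)).2 fun i => ?_
    rw [← hcoord x i]
    refine ((estar i).le_opNorm _).trans ?_
    exact (mul_le_mul_of_nonneg_left hx (norm_nonneg _)).trans
      (Finset.single_le_sum (f := fun i : Fin (k + 1) => ‖estar i‖ * ρ k) (fun i _ => hnn i)
        (Finset.mem_univ i))
  obtain ⟨c, hc, u, hu, hu'⟩ := exists_palaisSmale_sequence (D := {x | ‖J x‖ ≤ ρ k})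
    (B := {x | ρ k ≤ ‖J x‖}) hI heven hJc hJneg
    (Metric.isCompact_of_isClosed_isBounded (isClosed_le hJc.norm continuous_const)
      (Metric.isBounded_closedBall.subset fun x hx => mem_closedBall_zero_iff.2 (hR x hx)))
    (isClosed_le continuous_const hJc.norm)
    (fun x hx => by simpa [hJneg] using hx) (fun x hx => by simpa [hJneg] using hx)
    (fun x hx hx' => hA2 k _ (Submodule.sum_mem _ fun i _ => Submodule.smul_mem _ _
      (Submodule.subset_span ⟨i, Nat.lt_succ_iff.1 i.2, rfl⟩)) (le_antisymm hx hx')) hM (by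
      intro φ hφ hφB
      obtain ⟨x, hx, hxr, hxZ⟩ := exists_mem_sphere_of_odd (γ := fun x => J x + φ x) hdual hdense
        (hr k) (hrρ k) (hJc.add φ.continuous) (fun x => by simp only [hJneg, hφ]; abel)
        (fun x hx => by simp only [hφB x hx, add_zero]; rfl) hR
      exact ⟨x, hx, hsphere _ hxZ hxr⟩)
  obtain ⟨v, φ, hφ, hv⟩ := hA3 c (hM.trans_le hc) u hu hu'
  refine ⟨v, ?_, ?_⟩
  · have h1 := ((hI.continuous_fderiv one_ne_zero).norm.tendsto v).comp hv
    exact norm_eq_zero.1 (tendsto_nhds_unique h1 (hu'.comp hφ.tendsto_atTop))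
  · have h1 := (hI.continuous.tendsto v).comp hv
    rw [tendsto_nhds_unique h1 (hu.comp hφ.tendsto_atTop)]
    linarith
end
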